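/- arXiv:1211.7160 — 2 statements merged into one kernel-verified Lean document; each statement's English description precedes it below -/
import Mathlib

section
/- For every nonzero real polynomial Φ of degree at most 9, there exists a 3-dimensional real linear subspace H of the space of real polynomials of degree at most 5 such that the Wronskian of some (equivalently, any) basis of H is a nonzero real scalar multiple of Φ. -/
open Polynomial

/-- The Wronskian of `m` polynomials: the determinant of the `m × m` matrix whose
`(i,j)` entry is the `(i-1)`-st derivative of `f j`. -/
noncomputable def Wr {K : Type*} [CommRing K] {m : ℕ} (f : Fin m → K[X]) : K[X] :=
  (Matrix.of fun i j : Fin m => (derivative^[(i : ℕ)] (f j))).det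

/-- A real polynomial of odd degree has a real root. -/
theorem exists_isRoot_of_odd_natDegree_real {p : ℝ[X]} (hp : Odd p.natDegree) :
    ∃ x, p.IsRoot x := by
  wlog hlc : 0 ≤ p.leadingCoeff generalizing p
  · obtain ⟨x, hx⟩ := this (p := -p) (by rwa [natDegree_neg])
      (by rw [leadingCoeff_neg]; linarith)
    exact ⟨x, by simpa [IsRoot] using hx⟩
  have hdeg : 0 < p.degree := natDegree_pos_iff_degree_pos.1 hp.pos
  have htop := p.tendsto_atTop_of_leadingCoeff_nonneg hdeg hlc
  have hbot := (p.comp (-X)).tendsto_atBot_of_leadingCoeff_nonpos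
    (by rw [← natDegree_pos_iff_degree_pos, natDegree_comp]; simpa using hp.pos)
    (by rw [leadingCoeff_comp (by simp)]; simp [hp.neg_one_pow, hlc])
  obtain ⟨b, hb0, hb⟩ := ((Filter.eventually_ge_atTop (0 : ℝ)).and
    (htop.eventually_ge_atTop 0)).exists
  obtain ⟨a, ha0, ha⟩ := ((Filter.eventually_ge_atTop (0 : ℝ)).and
    (hbot.eventually_le_atBot 0)).exists
  obtain ⟨x, -, hx⟩ := intermediate_value_Icc (show -a ≤ b by linarith) p.continuous.continuousOn
    (Set.mem_Icc.2 ⟨by simpa using ha, hb⟩)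
  exact ⟨x, hx⟩

/-- If `A` acts irreducibly on `V` and `g` acts with negative determinant, then `A` acts through a
real character, which is negative at `g`. -/
theorem exists_algHom_neg_of_forall_invariant {A V : Type*} [CommRing A] [Algebra ℝ A]
    [AddCommGroup V] [Module ℝ V] [FiniteDimensional ℝ V] [Nontrivial V]
    (ρ : A →ₐ[ℝ] Module.End ℝ V)
    (hV : ∀ W : Submodule ℝ V, (∀ a, W ≤ W.comap (ρ a)) → W = ⊥ ∨ W = ⊤) (g : A)
    (hg : LinearMap.det (ρ g) < 0) :
    ∃ χ : A →ₐ[ℝ] ℝ, χ g < 0 ∧ ∀ a, ρ a = 0 → χ a = 0 := by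
  have scalar : ∀ (a : A) (r : ℝ), (ρ a).charpoly.IsRoot r → ρ a = r • 1 := by
    intro a r hr
    have hr' := (Module.End.hasEigenvalue_iff_isRoot_charpoly _ _).2 hr
    have hW := (hV (Module.End.eigenspace (ρ a) r) fun b x hx => by
      rw [Submodule.mem_comap, Module.End.mem_eigenspace_iff] at *
      rw [← Module.End.mul_apply, ← map_mul, mul_comm, map_mul, Module.End.mul_apply, hx,
        map_smul]).resolve_left hr'
    ext x
    exact Module.End.mem_eigenspace_iff.1 (hW ▸ Submodule.mem_top (x := x))
  obtain ⟨μ, hμ0, hμ⟩ : ∃ μ : ℝ, 0 < μ ∧ (ρ (-g)).charpoly.IsRoot μ := by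
    obtain ⟨q, hq⟩ : ∃ q, (ρ (-g)).charpoly = q := ⟨_, rfl⟩
    have h0 : q.eval 0 < 0 := by
      have h1 : LinearMap.det (ρ g) = q.coeff 0 := by
        have h2 : ρ g = (-1 : ℝ) • ρ (-g) := by rw [map_neg]; simp
        rw [h2, LinearMap.det_smul, LinearMap.det_eq_sign_charpoly_coeff, ← mul_assoc, ← mul_pow,
          hq]
        norm_num
      rwa [← coeff_zero_eq_eval_zero, ← h1]
    have hmon : q.Monic := hq ▸ LinearMap.charpoly_monic _
    have hdeg : 0 < q.degree := by
      rw [← natDegree_pos_iff_degree_pos, ← hq, LinearMap.charpoly_natDegree]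
      exact Module.finrank_pos
    have htop := q.tendsto_atTop_of_leadingCoeff_nonneg hdeg (by rw [hmon.leadingCoeff]; simp)
    obtain ⟨b, hb0, hb⟩ := ((Filter.eventually_gt_atTop (0 : ℝ)).and
      (htop.eventually_gt_atTop 0)).exists
    obtain ⟨μ, hμ, hμ'⟩ := intermediate_value_Ioo hb0.le q.continuous.continuousOn
      (Set.mem_Ioo.2 ⟨h0, hb⟩)
    exact ⟨μ, hμ.1, hq ▸ hμ'⟩
  have hgs : ρ g = (-μ) • 1 := by
    have := scalar (-g) μ hμ
    rw [map_neg] at this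
    rw [neg_smul, ← this, neg_neg]
  have hodd : Odd (Module.finrank ℝ V) := by
    rw [hgs, LinearMap.det_smul, map_one, mul_one] at hg
    by_contra h
    rw [Nat.not_odd_iff_even] at h
    exact absurd hg (not_lt.2 (h.pow_nonneg _))
  have hex : ∀ a : A, ∃ r : ℝ, ρ a = r • 1 := by
    intro a
    obtain ⟨r, hr⟩ := exists_isRoot_of_odd_natDegree_real
      (p := (ρ a).charpoly) (by rwa [LinearMap.charpoly_natDegree])
    exact ⟨r, scalar a r hr⟩
  choose χ hχ using hex
  have uniq : ∀ r s : ℝ, r • (1 : Module.End ℝ V) = s • 1 → r = s :=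
    fun r s h => smul_left_injective ℝ one_ne_zero h
  refine ⟨{ toFun := χ, map_one' := ?_, map_mul' := ?_, map_zero' := ?_, map_add' := ?_,
            commutes' := ?_ }, ?_, ?_⟩
  · exact uniq _ _ (by rw [← hχ, map_one, one_smul])
  · intro a b
    exact uniq _ _ (by rw [← hχ, map_mul, hχ a, hχ b, smul_mul_smul_comm, one_mul])
  · exact uniq _ _ (by rw [← hχ, map_zero, zero_smul])
  · intro a b
    exact uniq _ _ (by rw [← hχ, map_add, hχ, hχ, add_smul])
  · intro r
    exact uniq _ _ (by rw [← hχ, AlgHom.commutes, Algebra.algebraMap_eq_smul_one]; rfl)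
  · have : χ g = -μ := uniq _ _ (by rw [← hχ, hgs])
    change χ g < 0
    linarith
  · intro a ha
    exact uniq _ _ (by change χ a • _ = _; rw [← hχ, ha, zero_smul])

/-- If `g` acts on a finite-dimensional real `A`-module with negative determinant, then some real
character of `A` that factors through the action is negative at `g`. -/
theorem exists_algHom_neg {A : Type*} [CommRing A] [Algebra ℝ A] (g : A) (V : Type*)
    [AddCommGroup V] [Module ℝ V] [FiniteDimensional ℝ V] (ρ : A →ₐ[ℝ] Module.End ℝ V)
    (hg : LinearMap.det (ρ g) < 0) :
    ∃ χ : A →ₐ[ℝ] ℝ, χ g < 0 ∧ ∀ a, ρ a = 0 → χ a = 0 := by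
  induction hn : Module.finrank ℝ V using Nat.strong_induction_on generalizing V with
  | _ n ih =>
  by_cases hV : ∀ W : Submodule ℝ V, (∀ a, W ≤ W.comap (ρ a)) → W = ⊥ ∨ W = ⊤
  · have : Nontrivial V := by
      by_contra h
      rw [not_nontrivial_iff_subsingleton] at h
      rw [LinearMap.det_eq_one_of_subsingleton] at hg
      linarith
    exact exists_algHom_neg_of_forall_invariant ρ hV g hg
  push Not at hV
  obtain ⟨W, hW, hbot, htop⟩ := hV
  rw [LinearMap.det_eq_det_mul_det W (ρ g) (hW g)] at hg
  have hcard := Submodule.finrank_quotient_add_finrank W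
  have hpos1 : 0 < Module.finrank ℝ W := by
    have : Nontrivial W := (Submodule.nontrivial_iff_ne_bot).2 hbot
    exact Module.finrank_pos
  have hpos2 : 0 < Module.finrank ℝ (V ⧸ W) := by
    have : Nontrivial (V ⧸ W) := Submodule.Quotient.nontrivial_iff.2 htop
    exact Module.finrank_pos
  let ρ₁ : A →ₐ[ℝ] Module.End ℝ W := AlgHom.ofLinearMap
    { toFun := fun a => (ρ a).restrict (hW a)
      map_add' := fun a b => by ext x; simp
      map_smul' := fun r a => by ext x; simp }
    (by ext x; simp) (fun a b => by ext x; simp)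
  let ρ₂ : A →ₐ[ℝ] Module.End ℝ (V ⧸ W) := AlgHom.ofLinearMap
    { toFun := fun a => W.mapQ W (ρ a) (hW a)
      map_add' := fun a b => by ext x; simp
      map_smul' := fun r a => by ext x; simp }
    (by ext x; simp) (fun a b => by ext x; simp)
  rcases (mul_neg_iff.1 hg).symm with ⟨h, -⟩ | ⟨-, h⟩
  · obtain ⟨χ, hχ, hχ'⟩ := ih (Module.finrank ℝ W) (by omega) W ρ₁ h rfl
    refine ⟨χ, hχ, fun a ha => hχ' a ?_⟩
    ext x
    simp [ρ₁, ha]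
  · obtain ⟨χ, hχ, hχ'⟩ := ih (Module.finrank ℝ (V ⧸ W)) (by omega) (V ⧸ W) ρ₂ h rfl
    refine ⟨χ, hχ, fun a ha => hχ' a ?_⟩
    ext x
    simp [ρ₂, ha]

theorem det_lsmul_quotient_span_singleton {a : ℝ[X]} (ha : a ≠ 0) :
    LinearMap.det (Algebra.lsmul ℝ ℝ (ℝ[X] ⧸ Ideal.span {a}) (X * (X - 1) : ℝ[X])) =
      a.eval 0 * a.eval 1 * (a.leadingCoeff⁻¹) ^ 2 := by
  have key : ∀ c : ℝ, Algebra.norm ℝ (algebraMap ℝ (AdjoinRoot a) c - AdjoinRoot.root a) =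
      a.eval c * a.leadingCoeff⁻¹ := by
    intro c
    have h := charpoly_leftMulMatrix (AdjoinRoot.powerBasis ha)
    rw [Algebra.norm_eq_matrix_det (AdjoinRoot.powerBasis ha).basis, map_sub, AlgHom.commutes,
      ← AdjoinRoot.powerBasis_gen ha, show ∀ n : Matrix (Fin (AdjoinRoot.powerBasis ha).dim) _ ℝ,
          algebraMap ℝ _ c - n =
        Matrix.scalar _ c - n from fun _ => rfl, ← Matrix.eval_charpoly, h,
      AdjoinRoot.powerBasis_gen ha, AdjoinRoot.minpoly_root ha, eval_mul, eval_C]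
  have h : LinearMap.det (Algebra.lsmul ℝ ℝ (ℝ[X] ⧸ Ideal.span {a}) (X * (X - 1) : ℝ[X])) =
      Algebra.norm ℝ ((algebraMap ℝ (AdjoinRoot a) 0 - AdjoinRoot.root a) *
        (algebraMap ℝ (AdjoinRoot a) 1 - AdjoinRoot.root a)) := by
    rw [Algebra.norm_apply]
    congr 1
    refine LinearMap.ext fun x => ?_
    obtain ⟨x, rfl⟩ := Ideal.Quotient.mk_surjective x
    change AdjoinRoot.mk a (X * (X - 1) * x) = _ * AdjoinRoot.mk a x
    rw [map_mul, map_mul, map_sub, AdjoinRoot.mk_X, map_one, map_zero, map_one]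
    ring
  rw [h, map_mul, key, key]
  ring

theorem Matrix.det_blockDiagonal_dependent {ι R : Type*} [Fintype ι] [LinearOrder ι] [CommRing R]
    {m : ι → Type*} [∀ i, Fintype (m i)] [∀ i, DecidableEq (m i)]
    (d : ∀ i, Matrix (m i) (m i) R) :
    (Matrix.blockDiagonal' d).det = ∏ i, (d i).det := by
  rw [(Matrix.blockTriangular_blockDiagonal' d).det_fintype]
  refine Finset.prod_congr rfl fun k _ => ?_
  rw [← Matrix.det_submatrix_equiv_self (Equiv.sigmaSubtype k).symm]
  congr 1
  ext i j
  exact Matrix.blockDiagonal'_apply_eq d k i j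

theorem det_pi_of_finite {ι : Type*} [Fintype ι] [LinearOrder ι] {K : Type*} [Field K] {V : ι →
    Type*}
    [∀ i, AddCommGroup (V i)] [∀ i, Module K (V i)] [∀ i, FiniteDimensional K (V i)]
    (f : ∀ i, V i →ₗ[K] V i) :
    LinearMap.det (LinearMap.pi fun i => (f i).comp (LinearMap.proj i)) =
      ∏ i, LinearMap.det (f i) := by
  let b := fun i => Module.finBasis K (V i)
  rw [← LinearMap.det_toMatrix (Pi.basis b)]
  have : LinearMap.toMatrix (Pi.basis b) (Pi.basis b)
      (LinearMap.pi fun i => (f i).comp (LinearMap.proj i)) =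
      Matrix.blockDiagonal' fun i => LinearMap.toMatrix (b i) (b i) (f i) := by
    ext ⟨i, j⟩ ⟨i', j'⟩
    rw [LinearMap.toMatrix_apply, Pi.basis_apply, Pi.basis_repr]
    by_cases h : i = i'
    · subst h
      simp [LinearMap.toMatrix_apply]
    · rw [Matrix.blockDiagonal'_apply_ne _ _ _ h]
      simp [h]
  rw [this, Matrix.det_blockDiagonal_dependent]
  simp

theorem exists_det_lsmul_quotient_range {ι M : Type*} [Fintype ι] [LinearOrder ι] [AddCommGroup M]
    [Module ℝ[X] M] [Module ℝ M] [IsScalarTower ℝ ℝ[X] M] (b : Module.Basis ι ℝ[X] M)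
    (φ : M →ₗ[ℝ[X]] M) (hφ : Function.Injective φ) :
    FiniteDimensional ℝ (M ⧸ LinearMap.range φ) ∧ ∃ c : ℝ, 0 < c ∧
      LinearMap.det (Algebra.lsmul ℝ ℝ (M ⧸ LinearMap.range φ) (X * (X - 1) : ℝ[X])) =
        c * ((LinearMap.det φ).eval 0 * (LinearMap.det φ).eval 1) := by
  have h : Module.finrank ℝ[X] (LinearMap.range φ) = Module.finrank ℝ[X] M :=
    LinearMap.finrank_range_of_inj hφ
  let a := Submodule.smithNormalFormCoeffs b h
  have ha : ∀ i, a i ≠ 0 := Submodule.smithNormalFormCoeffs_ne_zero b h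
  let e := ((LinearMap.range φ).quotientEquivPiSpan b h).restrictScalars ℝ
  have fin : ∀ i, FiniteDimensional ℝ (ℝ[X] ⧸ Ideal.span {a i}) := fun i =>
    PowerBasis.finite <| AdjoinRoot.powerBasis (ha i)
  have hassoc : Associated (LinearMap.det φ) (∏ i, a i) := by
    let b' := Submodule.smithNormalFormTopBasis b h
    let ab := Submodule.smithNormalFormBotBasis b h
    rw [← Matrix.det_diagonal, ← LinearMap.det_toLin b']
    let e' := (b'.equiv ab (Equiv.refl _)).trans (LinearEquiv.ofInjective φ hφ).symm
    refine (LinearMap.associated_det_of_eq_comp e' _ _ ?_).symm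
    intro x
    have h1 : ∀ y, φ (e' y) = (b'.equiv ab (Equiv.refl _) y : M) := fun y => by
      conv_rhs => rw [← (LinearEquiv.ofInjective φ hφ).apply_symm_apply (b'.equiv ab _ y)]
      rfl
    rw [h1]
    revert x
    suffices H : Matrix.toLin b' b' (Matrix.diagonal a) =
        (LinearMap.range φ).subtype ∘ₗ (b'.equiv ab (Equiv.refl _)).toLinearMap from
      fun x => LinearMap.congr_fun H x
    refine b'.ext fun i => ?_
    rw [Matrix.toLin_self]
    simp [Matrix.diagonal_apply, ab, b', a, Submodule.smithNormalFormBotBasis_def]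
  have hdet : LinearMap.det (Algebra.lsmul ℝ ℝ (M ⧸ LinearMap.range φ) (X * (X - 1) : ℝ[X])) =
      ∏ i, ((a i).eval 0 * (a i).eval 1 * ((a i).leadingCoeff⁻¹) ^ 2) := by
    rw [← LinearMap.det_conj _ e]
    simp_rw [← det_lsmul_quotient_span_singleton (ha _)]
    rw [← det_pi_of_finite]
    congr 1
    refine LinearMap.ext fun x => ?_
    obtain ⟨x, rfl⟩ := e.surjective x
    simp only [LinearMap.comp_apply, LinearEquiv.coe_coe, LinearEquiv.symm_apply_apply]
    exact map_smul ((LinearMap.range φ).quotientEquivPiSpan b h) (X * (X - 1) : ℝ[X]) x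
  refine ⟨e.symm.finiteDimensional, ?_⟩
  obtain ⟨u, hu⟩ := hassoc.symm
  obtain ⟨r, hr, hr'⟩ := Polynomial.isUnit_iff.1 u.isUnit
  have hr0 := hr.ne_zero
  refine ⟨(r⁻¹) ^ 2 * ∏ i, ((a i).leadingCoeff⁻¹) ^ 2, ?_, ?_⟩
  · have h1 : 0 < ∏ i, ((a i).leadingCoeff⁻¹) ^ 2 := Finset.prod_pos fun i _ =>
      sq_pos_of_ne_zero (inv_ne_zero (leadingCoeff_ne_zero.2 (ha i)))
    have h2 : r⁻¹ ≠ 0 := inv_ne_zero hr0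
    positivity
  · rw [hdet, ← hu, ← hr', eval_mul, eval_mul, eval_C, eval_C, eval_prod, eval_prod,
      Finset.prod_mul_distrib, Finset.prod_mul_distrib]
    field_simp

theorem exists_ringHom_of_det_eval_mul_neg {n T : Type*} [Fintype n] [LinearOrder n] [CommRing T]
    [Algebra ℝ[X] T] (j : T →ₐ[ℝ[X]] Matrix n n ℝ[X]) (m : T)
    (hm : (j m).det.eval 0 * (j m).det.eval 1 < 0) :
    ∃ (τ : ℝ) (χ : T →+* ℝ), 0 < τ ∧ τ < 1 ∧ (∀ p : ℝ[X], χ (algebraMap ℝ[X] T p) = p.eval τ) ∧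
      χ m = 0 := by
  let : Algebra ℝ T := Algebra.compHom T (C : ℝ →+* ℝ[X])
  have hdet0 : (j m).det ≠ 0 := by
    intro h
    simp [h] at hm
  have hinj : Function.Injective (Matrix.toLin' (j m)) := by
    rw [← LinearMap.ker_eq_bot, LinearMap.ker_eq_bot']
    intro x hx
    exact Matrix.eq_zero_of_mulVec_eq_zero hdet0 hx
  obtain ⟨hfin, c, hc, hcdet⟩ := exists_det_lsmul_quotient_range
    (Pi.basisFun ℝ[X] n) (Matrix.toLin' (j m)) hinj
  rw [LinearMap.det_toLin'] at hcdet
  set N := LinearMap.range (Matrix.toLin' (j m)) with hN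
  have hinv : ∀ t : T, N ≤ N.comap (Matrix.toLin' (j t)) := by
    rintro t _ ⟨x, rfl⟩
    refine ⟨Matrix.toLin' (j t) x, ?_⟩
    rw [← Matrix.toLin'_mul_apply, ← Matrix.toLin'_mul_apply, ← map_mul, ← map_mul, mul_comm]
  let ρ : T →ₐ[ℝ] Module.End ℝ ((n → ℝ[X]) ⧸ N) := AlgHom.ofLinearMap
    { toFun := fun t => (N.mapQ N (Matrix.toLin' (j t)) (hinv t)).restrictScalars ℝ
      map_add' := fun a b => by
        refine LinearMap.ext fun x => ?_
        obtain ⟨x, rfl⟩ := Submodule.Quotient.mk_surjective N x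
        simp
      map_smul' := fun r a => by
        refine LinearMap.ext fun x => ?_
        obtain ⟨x, rfl⟩ := Submodule.Quotient.mk_surjective N x
        have h1 : r • a = (C r : ℝ[X]) • a := by
          rw [Algebra.smul_def, Algebra.smul_def]; rfl
        have h2 : ∀ y : (n → ℝ[X]) ⧸ N, r • y = (C r : ℝ[X]) • y := fun y => by
          rw [← algebraMap_smul ℝ[X] r y]; rfl
        simp [h1, h2] }
    (by
      refine LinearMap.ext fun x => ?_
      obtain ⟨x, rfl⟩ := Submodule.Quotient.mk_surjective N x
      simp)
    (fun a b => by
      refine LinearMap.ext fun x => ?_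
      obtain ⟨x, rfl⟩ := Submodule.Quotient.mk_surjective N x
      simp)
  have hρX : ∀ p : ℝ[X], ρ (algebraMap ℝ[X] T p) = Algebra.lsmul ℝ ℝ ((n → ℝ[X]) ⧸ N) p := by
    intro p
    refine LinearMap.ext fun x => ?_
    obtain ⟨x, rfl⟩ := Submodule.Quotient.mk_surjective N x
    change N.mapQ N (Matrix.toLin' (j (algebraMap ℝ[X] T p))) (hinv _) (N.mkQ x) = p • N.mkQ x
    rw [Submodule.mkQ_apply, Submodule.mapQ_apply, AlgHom.commutes, ← Submodule.Quotient.mk_smul,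
      Matrix.toLin'_apply, Algebra.algebraMap_eq_smul_one, Matrix.smul_mulVec, Matrix.one_mulVec]
  have hneg : LinearMap.det (ρ (algebraMap ℝ[X] T (X * (X - 1)))) < 0 := by
    rw [hρX, hcdet]
    exact mul_neg_of_pos_of_neg hc hm
  obtain ⟨χ, hχ, hχ0⟩ := exists_algHom_neg _ _ ρ hneg
  let τ := χ (algebraMap ℝ[X] T X)
  have hτ : ∀ p : ℝ[X], χ (algebraMap ℝ[X] T p) = p.eval τ := by
    intro p
    have : ((χ : T →+* ℝ).comp (algebraMap ℝ[X] T)) = evalRingHom τ := by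
      refine Polynomial.ringHom_ext (fun a => ?_) (by simp [τ])
      simp only [RingHom.comp_apply, coe_evalRingHom, eval_C]
      exact χ.commutes a
    exact congrArg (· p) (congrArg DFunLike.coe this)
  rw [hτ] at hχ
  simp only [eval_mul, eval_X, eval_sub, eval_one] at hχ
  refine ⟨τ, χ, ?_, ?_, hτ, hχ0 m ?_⟩
  · nlinarith
  · nlinarith
  · refine LinearMap.ext fun x => ?_
    obtain ⟨x, rfl⟩ := Submodule.Quotient.mk_surjective N x
    change N.mapQ N (Matrix.toLin' (j m)) (hinv _) (N.mkQ x) = 0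
    rw [Submodule.mkQ_apply, Submodule.mapQ_apply, Submodule.Quotient.mk_eq_zero]
    exact ⟨x, rfl⟩

section
variable {R : Type*} [CommRing R]

/-- Multiplication by `v` on `R[v, w] / (v w - A, w² + s w - E₀ - E₁ v - E₂ v² - v⁴)` in the basis
`1, v, v², v³, v⁴, w`. -/
def mulV (A E₀ E₁ E₂ s : R) : Matrix (Fin 6) (Fin 6) R :=
  !![0, 0, 0, 0, s * A, A;
     1, 0, 0, 0, -E₀, 0;
     0, 1, 0, 0, -E₁, 0;
     0, 0, 1, 0, -E₂, 0;
     0, 0, 0, 1, 0, 0;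
     0, 0, 0, 0, A, 0]

/-- Multiplication by `w` on the algebra of `mulV`, in the same basis. -/
def mulW (A E₀ E₁ E₂ s : R) : Matrix (Fin 6) (Fin 6) R :=
  !![0, A, 0, 0, 0, E₀;
     0, 0, A, 0, 0, E₁;
     0, 0, 0, A, 0, E₂;
     0, 0, 0, 0, A, 0;
     0, 0, 0, 0, 0, 1;
     1, 0, 0, 0, 0, -s]

theorem mulV_mul_mulW (A E₀ E₁ E₂ s : R) :
    mulV A E₀ E₁ E₂ s * mulW A E₀ E₁ E₂ s = A • 1 := by
  ext i j
  fin_cases i <;> fin_cases j <;> simp [mulV, mulW, Matrix.mul_apply, Fin.sum_univ_succ] <;> ring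

theorem mulW_mul_mulV (A E₀ E₁ E₂ s : R) :
    mulW A E₀ E₁ E₂ s * mulV A E₀ E₁ E₂ s = A • 1 := by
  ext i j
  fin_cases i <;> fin_cases j <;> simp [mulV, mulW, Matrix.mul_apply, Fin.sum_univ_succ] <;> ring

theorem mulV_sq (A E₀ E₁ E₂ s : R) : mulV A E₀ E₁ E₂ s ^ 2 =
    !![0, 0, 0, s * A, A ^ 2, 0;
     0, 0, 0, -E₀, s * A, A;
     1, 0, 0, -E₁, -E₀, 0;
     0, 1, 0, -E₂, -E₁, 0;
     0, 0, 1, 0, -E₂, 0;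
     0, 0, 0, A, 0, 0] := by
  rw [pow_two]
  ext i j
  fin_cases i <;> fin_cases j <;> simp [mulV, Matrix.mul_apply, Fin.sum_univ_succ] <;> ring

theorem mulV_cube (A E₀ E₁ E₂ s : R) : mulV A E₀ E₁ E₂ s ^ 3 =
    !![0, 0, s * A, A ^ 2, -E₂ * s * A, 0;
     0, 0, -E₀, s * A, A ^ 2 + E₂ * E₀, 0;
     0, 0, -E₁, -E₀, s * A + E₂ * E₁, A;
     1, 0, -E₂, -E₁, -E₀ + E₂ ^ 2, 0;
     0, 1, 0, -E₂, -E₁, 0;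
     0, 0, A, 0, -A * E₂, 0] := by
  rw [pow_succ', mulV_sq]
  ext i j
  fin_cases i <;> fin_cases j <;> simp [mulV, Matrix.mul_apply, Fin.sum_univ_succ] <;> ring

theorem mulV_pow_four (A E₀ E₁ E₂ s : R) : mulV A E₀ E₁ E₂ s ^ 4 =
    !![0, s * A, A ^ 2, -E₂ * s * A, -E₁ * s * A - E₂ * A ^ 2, 0;
     0, -E₀, s * A, A ^ 2 + E₂ * E₀, E₁ * E₀ - E₂ * s * A, 0;
     0, -E₁, -E₀, s * A + E₂ * E₁, E₁ ^ 2 + E₂ * E₀ + A ^ 2, 0;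
     0, -E₂, -E₁, -E₀ + E₂ ^ 2, 2 * E₁ * E₂ + s * A, A;
     1, 0, -E₂, -E₁, E₂ ^ 2 - E₀, 0;
     0, A, 0, -A * E₂, -A * E₁, 0] := by
  rw [pow_succ', mulV_cube]
  ext i j
  fin_cases i <;> fin_cases j <;> simp [mulV, Matrix.mul_apply, Fin.sum_univ_succ] <;> ring

theorem mulW_mul_mulW (A E₀ E₁ E₂ s : R) :
    mulW A E₀ E₁ E₂ s * mulW A E₀ E₁ E₂ s = E₀ • 1 + E₁ • mulV A E₀ E₁ E₂ s +
      E₂ • mulV A E₀ E₁ E₂ s ^ 2 + mulV A E₀ E₁ E₂ s ^ 4 - s • mulW A E₀ E₁ E₂ s := by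
  rw [mulV_sq, mulV_pow_four]
  ext i j
  fin_cases i <;> fin_cases j <;>
    simp [mulV, mulW, Matrix.mul_apply, Fin.sum_univ_succ] <;> ring

/-- Multiplication by `F₀ + F₁ v + F₂ v² + F₃ v³ + G w` on the algebra of `mulV`. -/
def mulMatrix (A E₀ E₁ E₂ s F₀ F₁ F₂ F₃ G : R) : Matrix (Fin 6) (Fin 6) R :=
  F₀ • 1 + F₁ • mulV A E₀ E₁ E₂ s + F₂ • mulV A E₀ E₁ E₂ s ^ 2 + F₃ • mulV A E₀ E₁ E₂ s ^ 3 +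
    G • mulW A E₀ E₁ E₂ s

theorem mulV_map {S : Type*} [CommRing S] (φ : R →+* S) (A E₀ E₁ E₂ s : R) :
    φ.mapMatrix (mulV A E₀ E₁ E₂ s) = mulV (φ A) (φ E₀) (φ E₁) (φ E₂) (φ s) := by
  ext i j
  fin_cases i <;> fin_cases j <;> simp [mulV]

theorem mulW_map {S : Type*} [CommRing S] (φ : R →+* S) (A E₀ E₁ E₂ s : R) :
    φ.mapMatrix (mulW A E₀ E₁ E₂ s) = mulW (φ A) (φ E₀) (φ E₁) (φ E₂) (φ s) := by
  ext i j
  fin_cases i <;> fin_cases j <;> simp [mulW]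

theorem mulMatrix_map {S : Type*} [CommRing S] (φ : R →+* S) (A E₀ E₁ E₂ s F₀ F₁ F₂ F₃ G : R) :
    φ.mapMatrix (mulMatrix A E₀ E₁ E₂ s F₀ F₁ F₂ F₃ G) =
      mulMatrix (φ A) (φ E₀) (φ E₁) (φ E₂) (φ s) (φ F₀) (φ F₁) (φ F₂) (φ F₃) (φ G) := by
  have hs : ∀ (r : R) (m : Matrix (Fin 6) (Fin 6) R),
      φ.mapMatrix (r • m) = φ r • φ.mapMatrix m := fun r m => by ext i j; simp
  simp only [mulMatrix, map_add, hs, map_pow, mulV_map, mulW_map, map_one]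

end

theorem Matrix.det_six_of_odd_pattern {R : Type*} [CommRing R]
    (a₁ a₂ a₃ b₁ b₂ b₃ c₁ c₂ c₃ d₁ d₂ d₃ e₁ e₂ e₃ f₁ f₂ f₃ : R) :
    !![0, a₁, 0, a₂, 0, a₃;
      b₁, 0, b₂, 0, b₃, 0;
      0, c₁, 0, c₂, 0, c₃;
      d₁, 0, d₂, 0, d₃, 0;
      0, e₁, 0, e₂, 0, e₃;
      f₁, 0, f₂, 0, f₃, 0].det =
      -(!![a₁, a₂, a₃; c₁, c₂, c₃; e₁, e₂, e₃].det * !![b₁, b₂, b₃; d₁, d₂, d₃; f₁, f₂,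
          f₃].det) := by
  simp [Matrix.det_succ_row_zero, Fin.sum_univ_succ, Fin.succAbove]
  ring

theorem det_mulMatrix_zero :
    (mulMatrix (512 / 125 : ℝ) (-512 / 625) 0 (-992 / 25) 0 0 (32 / 25) 0 1 (-11 / 15)).det < 0 := by
  have : mulMatrix (512 / 125 : ℝ) (-512 / 625) 0 (-992 / 25) 0 0 (32 / 25) 0 1 (-11 / 15) =
      !![0, -5632 / 1875, 0, 262144 / 15625, 0, 54784 / 9375;
        32 / 25, 0, -4096 / 1875, 0, 786432 / 15625, 0;
        0, 32 / 25, 0, -4096 / 1875, 0, 12448 / 375;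
        1, 0, 1024 / 25, 0, 3043328 / 1875, 0;
        0, 1, 0, 1024 / 25, 0, -11 / 15;
        -11 / 15, 0, 512 / 125, 0, 524288 / 3125, 0] := by
    rw [mulMatrix, mulV_sq, mulV_cube]
    ext i j
    fin_cases i <;> fin_cases j <;> simp [mulV, mulW] <;> norm_num
  rw [this, Matrix.det_six_of_odd_pattern]
  simp [Matrix.det_fin_three]
  norm_num

theorem det_mulMatrix_one {R : Type*} [CommRing R] (A E₀ E₂ F₀ F₂ : R) :
    (mulMatrix A E₀ 0 E₂ 0 F₀ 0 F₂ 0 0).det =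
      (F₀ ^ 2 * (F₀ - F₂ * E₂) + F₀ * F₂ ^ 2 * E₀ + F₂ ^ 3 * A ^ 2) ^ 2 := by
  have : mulMatrix A E₀ 0 E₂ 0 F₀ 0 F₂ 0 0 =
      !![F₀, 0, 0, 0, F₂ * A ^ 2, 0;
        0, F₀, 0, -F₂ * E₀, 0, F₂ * A;
        F₂, 0, F₀, 0, -F₂ * E₀, 0;
        0, F₂, 0, F₀ - F₂ * E₂, 0, 0;
        0, 0, F₂, 0, F₀ - F₂ * E₂, 0;
        0, 0, 0, F₂ * A, 0, F₀] := by
    rw [mulMatrix, mulV_sq, mulV_cube]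
    ext i j
    fin_cases i <;> fin_cases j <;> simp [mulV, mulW] <;> ring
  rw [this]
  simp [Matrix.det_succ_row_zero, Fin.sum_univ_succ, Fin.succAbove]
  ring

/-- If the determinant of `mulMatrix` changes sign between `0` and `1`,
    then the three equations have a
common real solution over some intermediate point. -/
theorem exists_eval_of_det_mulMatrix (A E₀ E₁ E₂ s F₀ F₁ F₂ F₃ G : ℝ[X])
    (h : (mulMatrix A E₀ E₁ E₂ s F₀ F₁ F₂ F₃ G).det.eval 0 *
      (mulMatrix A E₀ E₁ E₂ s F₀ F₁ F₂ F₃ G).det.eval 1 < 0) :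
    ∃ τ v w : ℝ, 0 < τ ∧ τ < 1 ∧ v * w = A.eval τ ∧
      w * w = E₀.eval τ + E₁.eval τ * v + E₂.eval τ * v ^ 2 + v ^ 4 - s.eval τ * w ∧
      F₀.eval τ + F₁.eval τ * v + F₂.eval τ * v ^ 2 + F₃.eval τ * v ^ 3 + G.eval τ * w = 0 := by
  set V := mulV A E₀ E₁ E₂ s with hV
  set W := mulW A E₀ E₁ E₂ s with hW
  have hVW := mulV_mul_mulW A E₀ E₁ E₂ s
  have hWV := mulW_mul_mulV A E₀ E₁ E₂ s
  have hWW := mulW_mul_mulW A E₀ E₁ E₂ s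
  let T := Algebra.adjoin ℝ[X] {V, W}
  have : IsMulCommutative T := Algebra.isMulCommutative_adjoin ℝ[X] (by
    rintro a (rfl | rfl) b (rfl | rfl)
    · rfl
    · rw [hVW, hWV]
    · rw [hVW, hWV]
    · rfl)
  let : CommRing T := { T.toRing with mul_comm := fun a b => this.is_comm.comm a b }
  let v : T := ⟨V, Algebra.subset_adjoin (by simp)⟩
  let w : T := ⟨W, Algebra.subset_adjoin (by simp)⟩
  have hval : T.val (F₀ • 1 + F₁ • v + F₂ • v ^ 2 + F₃ • v ^ 3 + G • w) =
      mulMatrix A E₀ E₁ E₂ s F₀ F₁ F₂ F₃ G := by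
    simp only [map_add, map_smul, map_one, map_pow]
    rfl
  obtain ⟨τ, χ, h0, h1, hχ, hχ0⟩ := exists_ringHom_of_det_eval_mul_neg T.val
    (F₀ • 1 + F₁ • v + F₂ • v ^ 2 + F₃ • v ^ 3 + G • w) (by rwa [hval])
  have hs : ∀ (p : ℝ[X]) (t : T), χ (p • t) = p.eval τ * χ t := fun p t => by
    rw [Algebra.smul_def, map_mul, hχ]
  have e1 : v * w = A • 1 := Subtype.ext hVW
  have e2 : w * w = E₀ • 1 + E₁ • v + E₂ • v ^ 2 + v ^ 4 - s • w := Subtype.ext hWW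
  refine ⟨τ, χ v, χ w, h0, h1, ?_, ?_, ?_⟩
  · simpa [hs] using congrArg χ e1
  · simpa [hs] using congrArg χ e2
  · simpa [hs] using hχ0

theorem exists_eval_of_det_mulMatrix_eval (A E₀ E₁ E₂ s F₀ F₁ F₂ F₃ G : ℝ[X])
    (h0 : (mulMatrix (A.eval 0) (E₀.eval 0) (E₁.eval 0) (E₂.eval 0) (s.eval 0) (F₀.eval 0)
      (F₁.eval 0) (F₂.eval 0) (F₃.eval 0) (G.eval 0)).det < 0)
    (h1 : 0 < (mulMatrix (A.eval 1) (E₀.eval 1) (E₁.eval 1) (E₂.eval 1) (s.eval 1) (F₀.eval 1)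
      (F₁.eval 1) (F₂.eval 1) (F₃.eval 1) (G.eval 1)).det) :
    ∃ τ v w : ℝ, 0 < τ ∧ τ < 1 ∧ v * w = A.eval τ ∧
      w * w = E₀.eval τ + E₁.eval τ * v + E₂.eval τ * v ^ 2 + v ^ 4 - s.eval τ * w ∧
      F₀.eval τ + F₁.eval τ * v + F₂.eval τ * v ^ 2 + F₃.eval τ * v ^ 3 + G.eval τ * w = 0 := by
  apply exists_eval_of_det_mulMatrix
  rw [← coe_evalRingHom, ← coe_evalRingHom, RingHom.map_det, RingHom.map_det, mulMatrix_map,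
    mulMatrix_map]
  exact mul_neg_of_neg_of_pos h0 h1

/-- The coefficients `chartA`, `chartE₀`, …,
    `chartG` define the system of equations in the three unknowns
`u`, `v`, `w` that expresses that `∑ pᵢ X^(8 - i)` (suitably normalized) is a Wronskian in the cell
of triples of polynomials with leading terms `X^2`, `X^4`, `X^5`. -/
noncomputable def chartA (u p₂ p₄ p₆ : ℝ) : ℝ :=
  -p₂ * p₄ + (64 / 25) * p₂ * u ^ 4 + (8 / 5) * p₂ ^ 2 * u ^ 2 + p₂ ^ 3 / 3 - (8 / 5) * p₄ * u ^ 2 +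
      p₆ + (512 / 375) * u ^ 6

noncomputable def chartE₀ (u p₂ p₃ p₄ p₅ p₆ p₈ : ℝ) : ℝ :=
  -(p₂ * p₃ ^ 2 + (13 / 5) * p₂ * p₄ * u ^ 2 - (2 / 3) * p₂ * p₆ - (448 / 375) * p₂ * u ^ 6 +
      (4 / 3) * p₂ ^ 2 * p₄ - (184 / 75) * p₂ ^ 2 * u ^ 4 - (71 / 45) * p₂ ^ 3 * u ^ 2 -
      p₂ ^ 4 / 3 - p₃ * p₅ + (8 / 5) * p₃ ^ 2 * u ^ 2 + (56 / 75) * p₄ * u ^ 4 - p₄ ^ 2 +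
      (3 / 5) * p₆ * u ^ 2 - p₈ + (512 / 5625) * u ^ 8)

noncomputable def chartE₁ (u p₂ p₃ p₅ : ℝ) : ℝ :=
  -(3 * p₂ * p₃ * u + (24 / 5) * p₃ * u ^ 3 - (5 / 3) * p₅ * u)

noncomputable def chartE₂ (u p₂ p₄ : ℝ) : ℝ :=
  -((148 / 45) * p₂ * u ^ 2 + p₂ ^ 2 / 3 - (2 / 3) * p₄ + (992 / 225) * u ^ 4)

noncomputable def chartF₀ (u p₂ p₃ p₅ p₇ : ℝ) : ℝ :=
  -(11 / 5) * p₂ * p₃ * u ^ 2 - p₂ ^ 2 * p₃ - (24 / 25) * p₃ * u ^ 4 - p₅ * u ^ 2 - p₇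

noncomputable def chartF₁ (u p₂ p₄ : ℝ) : ℝ :=
  (4 / 15) * p₂ * u ^ 3 - (1 / 3) * p₂ ^ 2 * u - 2 * p₄ * u + (32 / 25) * u ^ 5

noncomputable def chartG (u p₂ : ℝ) : ℝ :=
  -2 * p₂ * u - (11 / 5) * u ^ 3

theorem exists_eval_eq_chartA (p₂ p₄ p₆ : ℝ) : ∃ P : ℝ[X], ∀ t : ℝ,
    P.eval t = chartA (1 - t) (p₂ * t ^ 2) (p₄ * t ^ 4) (p₆ * t ^ 6) :=
  ⟨-(C p₂ * X ^ 2) * (C p₄ * X ^ 4) + C (64 / 25) * (C p₂ * X ^ 2) * (1 - X) ^ 4 +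
      C (8 / 5) * (C p₂ * X ^ 2) ^ 2 * (1 - X) ^ 2 + C (1 / 3) * (C p₂ * X ^ 2) ^ 3 -
      C (8 / 5) * (C p₄ * X ^ 4) * (1 - X) ^ 2 + (C p₆ * X ^ 6) + C (512 / 375) * (1 - X) ^ 6,
    fun t => by simp only [chartA, eval_mul, eval_add, eval_sub, eval_neg, eval_pow, eval_C, eval_X,
      eval_one]; ring⟩

theorem exists_eval_eq_chartE₀ (p₂ p₃ p₄ p₅ p₆ p₈ : ℝ) : ∃ P : ℝ[X], ∀ t : ℝ,
    P.eval t = chartE₀ (1 -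
        t) (p₂ * t ^ 2) (p₃ * t ^ 3) (p₄ * t ^ 4) (p₅ * t ^ 5) (p₆ * t ^ 6) (p₈ * t ^ 8) :=
  ⟨-((C p₂ * X ^ 2) * (C p₃ * X ^ 3) ^ 2 + C (13 / 5) * (C p₂ * X ^ 2) * (C p₄ * X ^ 4) * (1 -
      X) ^ 2 - C (2 / 3) * (C p₂ * X ^ 2) * (C p₆ * X ^ 6) - C (448 / 375) * (C p₂ * X ^ 2) * (1 -
      X) ^ 6 + C (4 / 3) * (C p₂ * X ^ 2) ^ 2 * (C p₄ * X ^ 4) -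
      C (184 / 75) * (C p₂ * X ^ 2) ^ 2 * (1 - X) ^ 4 - C (71 / 45) * (C p₂ * X ^ 2) ^ 3 * (1 -
      X) ^ 2 - C (1 / 3) * (C p₂ * X ^ 2) ^ 4 - (C p₃ * X ^ 3) * (C p₅ * X ^ 5) +
      C (8 / 5) * (C p₃ * X ^ 3) ^ 2 * (1 - X) ^ 2 + C (56 / 75) * (C p₄ * X ^ 4) * (1 - X) ^ 4 -
      (C p₄ * X ^ 4) ^ 2 + C (3 / 5) * (C p₆ * X ^ 6) * (1 - X) ^ 2 - (C p₈ * X ^ 8) +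
      C (512 / 5625) * (1 - X) ^ 8),
    fun t => by simp only [chartE₀, eval_mul, eval_add, eval_sub, eval_neg, eval_pow, eval_C,
        eval_X,
      eval_one]; ring⟩

theorem exists_eval_eq_chartE₁ (p₂ p₃ p₅ : ℝ) : ∃ P : ℝ[X], ∀ t : ℝ,
    P.eval t = chartE₁ (1 - t) (p₂ * t ^ 2) (p₃ * t ^ 3) (p₅ * t ^ 5) :=
  ⟨-(3 * (C p₂ * X ^ 2) * (C p₃ * X ^ 3) * (1 - X) + C (24 / 5) * (C p₃ * X ^ 3) * (1 - X) ^ 3 -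
      C (5 / 3) * (C p₅ * X ^ 5) * (1 - X)),
    fun t => by simp only [chartE₁, eval_mul, eval_add, eval_sub, eval_neg, eval_pow, eval_C,
        eval_X,
      eval_one, eval_ofNat]⟩

theorem exists_eval_eq_chartE₂ (p₂ p₄ : ℝ) : ∃ P : ℝ[X], ∀ t : ℝ,
    P.eval t = chartE₂ (1 - t) (p₂ * t ^ 2) (p₄ * t ^ 4) :=
  ⟨-(C (148 / 45) * (C p₂ * X ^ 2) * (1 - X) ^ 2 + C (1 / 3) * (C p₂ * X ^ 2) ^ 2 -
      C (2 / 3) * (C p₄ * X ^ 4) + C (992 / 225) * (1 - X) ^ 4),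
    fun t => by simp only [chartE₂, eval_mul, eval_add, eval_sub, eval_neg, eval_pow, eval_C,
        eval_X,
      eval_one]; ring⟩

theorem exists_eval_eq_chartF₀ (p₂ p₃ p₅ p₇ : ℝ) : ∃ P : ℝ[X], ∀ t : ℝ,
    P.eval t = chartF₀ (1 - t) (p₂ * t ^ 2) (p₃ * t ^ 3) (p₅ * t ^ 5) (p₇ * t ^ 7) :=
  ⟨-C (11 / 5) * (C p₂ * X ^ 2) * (C p₃ * X ^ 3) * (1 - X) ^ 2 -
      (C p₂ * X ^ 2) ^ 2 * (C p₃ * X ^ 3) - C (24 / 25) * (C p₃ * X ^ 3) * (1 - X) ^ 4 -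
      (C p₅ * X ^ 5) * (1 - X) ^ 2 - (C p₇ * X ^ 7),
    fun t => by simp only [chartF₀, eval_mul, eval_sub, eval_neg, eval_pow, eval_C, eval_X,
      eval_one]⟩

theorem exists_eval_eq_chartF₁ (p₂ p₄ : ℝ) : ∃ P : ℝ[X], ∀ t : ℝ,
    P.eval t = chartF₁ (1 - t) (p₂ * t ^ 2) (p₄ * t ^ 4) :=
  ⟨C (4 / 15) * (C p₂ * X ^ 2) * (1 - X) ^ 3 - C (1 / 3) * (C p₂ * X ^ 2) ^ 2 * (1 - X) -
      2 * (C p₄ * X ^ 4) * (1 - X) + C (32 / 25) * (1 - X) ^ 5,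
    fun t => by simp only [chartF₁, eval_mul, eval_add, eval_sub, eval_pow, eval_C, eval_X,
      eval_one, eval_ofNat]⟩

theorem exists_eval_eq_chartG (p₂ : ℝ) : ∃ P : ℝ[X], ∀ t : ℝ,
    P.eval t = chartG (1 - t) (p₂ * t ^ 2) :=
  ⟨-2 * (C p₂ * X ^ 2) * (1 - X) - C (11 / 5) * (1 - X) ^ 3,
    fun t => by simp only [chartG, eval_mul, eval_sub, eval_neg, eval_pow, eval_C, eval_X,
      eval_one, eval_ofNat]⟩

/-- The system is weighted homogeneous in `u, p₂, …, p₈`,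
    so it can be deformed along the segment from
`u = 1, p = 0` to `u = 0`. -/
theorem exists_reduced_solution (p₂ p₃ p₄ p₅ p₆ p₇ p₈ : ℝ)
    (hN : (-(p₂ ^ 2 * p₃) - p₇) ^ 2 * (-(p₂ ^ 2 * p₃) - p₇ - p₃ * (-3 * p₂ ^ 2 + 6 * p₄)) +
        (-(p₂ ^ 2 * p₃) - p₇) * p₃ ^ 2 * (-9 * (p₂ * p₃ ^ 2 - (2 / 3) * p₂ * p₆ +
        (4 / 3) * p₂ ^ 2 * p₄ - p₂ ^ 4 / 3 - p₃ * p₅ - p₄ ^ 2 - p₈)) + p₃ ^ 3 * (3 * (-p₂ * p₄ +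
        p₂ ^ 3 / 3 + p₆)) ^ 2 ≠ 0) :
    ∃ u v w : ℝ, v * w = chartA u p₂ p₄ p₆ ∧
      w ^ 2 = chartE₀ u p₂ p₃ p₄ p₅ p₆ p₈ + chartE₁ u p₂ p₃ p₅ * v + chartE₂ u p₂ p₄ * v ^ 2 +
          v ^ 4 / 9 - p₃ * u * w ∧
      chartF₀ u p₂ p₃ p₅ p₇ + chartF₁ u p₂ p₄ * v + p₃ * v ^ 2 + u * v ^ 3 + chartG u p₂ * w =
          0 := by
  obtain ⟨A, hA⟩ := exists_eval_eq_chartA p₂ p₄ p₆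
  obtain ⟨E0, hE0⟩ := exists_eval_eq_chartE₀ p₂ p₃ p₄ p₅ p₆ p₈
  obtain ⟨E1, hE1⟩ := exists_eval_eq_chartE₁ p₂ p₃ p₅
  obtain ⟨E2, hE2⟩ := exists_eval_eq_chartE₂ p₂ p₄
  obtain ⟨F0, hF0⟩ := exists_eval_eq_chartF₀ p₂ p₃ p₅ p₇
  obtain ⟨F1, hF1⟩ := exists_eval_eq_chartF₁ p₂ p₄
  obtain ⟨G, hG⟩ := exists_eval_eq_chartG p₂
  obtain ⟨τ, v, w, h0, -, e1, e2, e3⟩ := exists_eval_of_det_mulMatrix_eval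
    (C 3 * A) (C 9 * E0) (C 9 * E1) (C 9 * E2) (C 3 * (C p₃ * X ^ 3 * (1 - X))) F0 F1
    (C p₃ * X ^ 3) (1 - X) (C (1 / 3) * G) (by
      convert det_mulMatrix_zero using 2
      simp only [eval_mul, eval_sub, eval_pow, eval_C, eval_X, eval_one, hA, hE0, hE1, hE2, hF0,
          hF1, hG]
      congr 1 <;> norm_num [chartA, chartE₀, chartE₁, chartE₂, chartF₀, chartF₁, chartG]) (by
      refine (lt_of_lt_of_eq (sq_pos_of_ne_zero hN) (Eq.trans ?_ (det_mulMatrix_one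
        (3 * chartA 0 p₂ p₄ p₆) (9 * chartE₀ 0 p₂ p₃ p₄ p₅ p₆ p₈) (9 * chartE₂ 0 p₂ p₄)
        (chartF₀ 0 p₂ p₃ p₅ p₇) p₃).symm)).trans_eq (congrArg Matrix.det ?_)
      · simp only [chartA, chartE₀, chartE₂, chartF₀]
        ring
      · simp only [eval_mul, eval_sub, eval_pow, eval_C, eval_X, eval_one, hA, hE0, hE1, hE2, hF0,
          hF1, hG, sub_self, one_pow,
          mul_one]
        congr 1 <;> simp [chartE₁, chartF₁, chartG])
  simp only [eval_mul, eval_sub, eval_pow, eval_C, eval_X, eval_one, hA, hE0, hE1, hE2, hF0, hF1,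
      hG] at e1 e2 e3
  have hτ := h0.ne'
  obtain ⟨u, hu⟩ : ∃ u, 1 - τ = u * τ := ⟨(1 - τ) / τ, by field_simp⟩
  obtain ⟨v, rfl⟩ : ∃ v', v = v' * τ ^ 2 := ⟨v / τ ^ 2, by field_simp⟩
  obtain ⟨w, rfl⟩ : ∃ w', w = 3 * w' * τ ^ 4 := ⟨w / (3 * τ ^ 4), by field_simp⟩
  rw [hu] at e1 e2 e3
  simp only [chartA, chartE₀, chartE₁, chartE₂, chartF₀, chartF₁, chartG] at e1 e2 e3 ⊢
  refine ⟨u, v, w, ?_, ?_, ?_⟩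
  · refine mul_left_cancel₀ (pow_ne_zero 6 hτ) ?_
    linear_combination e1 / 3
  · refine mul_left_cancel₀ (pow_ne_zero 8 hτ) ?_
    linear_combination e2 / 9
  · refine (mul_eq_zero.1 (?_ : τ ^ 7 * _ = 0)).resolve_left (pow_ne_zero 7 hτ)
    linear_combination e3

section
variable {R : Type*} [CommRing R]

/-- The polynomial `∑ i < n, a i * X ^ i`. -/
noncomputable def ofCoeffs (R : Type*) [CommRing R] (n : ℕ) : (Fin n → R) →ₗ[R] R[X] :=
  (degreeLT R n).subtype ∘ₗ (degreeLTEquiv R n).symm.toLinearMap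

theorem ofCoeffs_apply {n : ℕ} (a : Fin n → R) :
    ofCoeffs R n a = ∑ i : Fin n, monomial i (a i) := rfl

theorem ofCoeffs_injective {n : ℕ} : Function.Injective (ofCoeffs R n) :=
  (Submodule.injective_subtype _).comp (degreeLTEquiv R n).symm.injective

theorem ofCoeffs_mem_degreeLT {n : ℕ} (a : Fin n → R) : ofCoeffs R n a ∈ degreeLT R n :=
  Subtype.property _

theorem exists_ofCoeffs_eq {n : ℕ} {p : R[X]} (hp : p ∈ degreeLT R n) :
    ∃ a, ofCoeffs R n a = p :=
  ⟨degreeLTEquiv R n ⟨p, hp⟩, by simp [ofCoeffs]⟩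

theorem coeff_ofCoeffs {n : ℕ} (a : Fin n → R) (i : Fin n) : (ofCoeffs R n a).coeff i = a i := by
  simp [ofCoeffs_apply, finsetSum_coeff, coeff_monomial, Fin.val_inj]

/-- The maximal minor of a `3 × 6` matrix in the columns `i`, `j`, `k`. -/
def rowMinor (F : Fin 3 → Fin 6 → R) (i j k : Fin 6) : R :=
  F 0 i * (F 1 j * F 2 k - F 1 k * F 2 j) - F 0 j * (F 1 i * F 2 k - F 1 k * F 2 i) +
    F 0 k * (F 1 i * F 2 j - F 1 j * F 2 i)

/-- The coefficients of the Wronskian of three polynomials of degree at most `5`, in terms of their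
coefficients. -/
def wronskiCoeff (F : Fin 3 → Fin 6 → R) : Fin 10 → R :=
  ![2 * rowMinor F 0 1 2,
    6 * rowMinor F 0 1 3,
    12 * rowMinor F 0 1 4 + 6 * rowMinor F 0 2 3,
    20 * rowMinor F 0 1 5 + 16 * rowMinor F 0 2 4 + 2 * rowMinor F 1 2 3,
    30 * rowMinor F 0 2 5 + 12 * rowMinor F 0 3 4 + 6 * rowMinor F 1 2 4,
    30 * rowMinor F 0 3 5 + 12 * rowMinor F 1 2 5 + 6 * rowMinor F 1 3 4,
    20 * rowMinor F 0 4 5 + 16 * rowMinor F 1 3 5 + 2 * rowMinor F 2 3 4,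
    12 * rowMinor F 1 4 5 + 6 * rowMinor F 2 3 5,
    6 * rowMinor F 2 4 5,
    2 * rowMinor F 3 4 5]

theorem Wr_ofCoeffs (F : Fin 3 → Fin 6 → R) :
    Wr (fun j => ofCoeffs R 6 (F j)) = ofCoeffs R 10 (wronskiCoeff F) := by
  simp only [Wr, Matrix.det_fin_three, Matrix.of_apply, ofCoeffs_apply, Fin.sum_univ_succ,
    wronskiCoeff, rowMinor, ← C_mul_X_pow_eq_monomial]
  simp [map_ofNat]
  ring

theorem wronskiCoeff_comp_rev (F : Fin 3 → Fin 6 → R) :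
    wronskiCoeff (fun j => F j ∘ Fin.rev) = -(wronskiCoeff F ∘ Fin.rev) := by
  ext n
  fin_cases n <;> simp [wronskiCoeff, rowMinor, Fin.rev] <;> ring

end

/-- A monic polynomial of degree `8` without term in `X^7` is a Wronskian,
    under a genericity condition. -/
theorem exists_wronskiCoeff_eq_of_ne_zero (p₂ p₃ p₄ p₅ p₆ p₇ p₈ : ℝ)
    (hN : (-(p₂ ^ 2 * p₃) - p₇) ^ 2 * (-(p₂ ^ 2 * p₃) - p₇ - p₃ * (-3 * p₂ ^ 2 + 6 * p₄)) +
        (-(p₂ ^ 2 * p₃) - p₇) * p₃ ^ 2 * (-9 * (p₂ * p₃ ^ 2 - (2 / 3) * p₂ * p₆ +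
        (4 / 3) * p₂ ^ 2 * p₄ - p₂ ^ 4 / 3 - p₃ * p₅ - p₄ ^ 2 - p₈)) + p₃ ^ 3 * (3 * (-p₂ * p₄ +
        p₂ ^ 3 / 3 + p₆)) ^ 2 ≠ 0) :
    ∃ F, wronskiCoeff F = (1 / 960 : ℝ) • ![960 * p₈, 960 * p₇, -960 * p₆, 320 * p₅, 240 * p₄,
      -48 * p₃, 40 / 3 * p₂, 0, 1, 0] := by
  obtain ⟨u, v, w, h₁, h₂, h₃⟩ := exists_reduced_solution p₂ p₃ p₄ p₅ p₆ p₇ p₈ hN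
  simp only [chartA, chartE₀, chartE₁, chartE₂, chartF₀, chartF₁, chartG] at h₁ h₂ h₃
  set e := p₂ + 8 / 5 * u ^ 2 with he
  set W := w - (p₂ / 3 + 8 / 15 * u ^ 2) * v with hW
  refine ⟨![![v + e, -u, 1 / 2, 0, 0, 0],
    ![W - p₄ - (v ^ 2 - e ^ 2) / 3, 5 / 3 * u * v + p₃, 0, u / 6, 1 / 24, 0],
    ![-p₂ * p₃ - 5 / 3 * p₂ * u * v - 8 / 5 * p₃ * u ^ 2 + p₅ - u * W - 8 / 3 * u ^ 3 * v,
      W + p₄ + (v ^ 2 - e ^ 2) / 3, 0, (v - e) / 6, 0, 1 / 120]], ?_⟩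
  ext n
  fin_cases n <;> simp [wronskiCoeff, rowMinor]
  · rw [hW, he]; linear_combination h₂ + (-2 / 3 * p₂ + 3 / 5 * u ^ 2) * h₁
  · rw [hW, he]; linear_combination h₃
  · rw [hW, he]; linear_combination -h₁
  all_goals first | (rw [hW, he]; ring) | (rw [he]; ring) | ring

section
variable {K : Type*} [Field K] [CharZero K]

theorem coeff_X_mul_derivative {R : Type*} [CommSemiring R] (p : R[X]) (n : ℕ) :
    (X * derivative p).coeff n = n * p.coeff n := by
  cases n with
  | zero => simp
  | succ n => rw [coeff_X_mul, coeff_derivative]; push_cast; ring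

theorem Wr_ne_zero_of_natDegree_ne {f g h : K[X]} (hf : f ≠ 0) (hg : g ≠ 0) (hh : h ≠ 0)
    (hfg : f.natDegree ≠ g.natDegree) (hfh : f.natDegree ≠ h.natDegree)
    (hgh : g.natDegree ≠ h.natDegree) : Wr ![f, g, h] ≠ 0 := by
  have hθ : ∀ p : K[X], (X * derivative p).natDegree ≤ p.natDegree := fun p =>
    natDegree_le_iff_coeff_eq_zero.2 fun n hn => by
      rw [coeff_X_mul_derivative, coeff_eq_zero_of_natDegree_lt hn, mul_zero]
  set θ : K[X] → K[X] := fun p => X * derivative p with hθdef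
  have hmul : ∀ p q r : K[X], (p * θ q * θ (θ r)).coeff (p.natDegree + q.natDegree + r.natDegree) =
      p.leadingCoeff * (q.natDegree * q.leadingCoeff) *
        (r.natDegree * (r.natDegree * r.leadingCoeff)) := fun p q r => by
    rw [coeff_mul_add_eq_of_natDegree_le (natDegree_mul_le_of_le le_rfl (hθ q))
      ((hθ _).trans (hθ r)), coeff_mul_add_eq_of_natDegree_le le_rfl (hθ q)]
    simp only [coeff_X_mul_derivative, coeff_natDegree]
  intro h0
  have key : f * θ g * θ (θ h) - f * θ h * θ (θ g) - g * θ f * θ (θ h) + g * θ h * θ (θ f)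
      + h * θ f * θ (θ g) - h * θ g * θ (θ f) = X ^ 3 * Wr ![f, g, h] := by
    simp [Wr, Matrix.det_fin_three, hθdef]
    ring
  rw [h0, mul_zero] at key
  have := congrArg (fun p => p.coeff (f.natDegree + g.natDegree + h.natDegree)) key
  simp only [coeff_sub, coeff_add, coeff_zero] at this
  rw [hmul f g h, show f.natDegree + g.natDegree + h.natDegree =
    f.natDegree + h.natDegree + g.natDegree by ring, hmul f h g,
    show f.natDegree + h.natDegree + g.natDegree =
    g.natDegree + f.natDegree + h.natDegree by ring, hmul g f h,
    show g.natDegree + f.natDegree + h.natDegree =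
    g.natDegree + h.natDegree + f.natDegree by ring, hmul g h f,
    show g.natDegree + h.natDegree + f.natDegree =
    h.natDegree + f.natDegree + g.natDegree by ring, hmul h f g,
    show h.natDegree + f.natDegree + g.natDegree =
    h.natDegree + g.natDegree + f.natDegree by ring, hmul h g f] at this
  have h1 : f.leadingCoeff * g.leadingCoeff * h.leadingCoeff *
      (((f.natDegree : K) - g.natDegree) * ((f.natDegree : K) - h.natDegree) *
        ((g.natDegree : K) - h.natDegree)) = 0 := by
    linear_combination -this
  simp only [mul_eq_zero, leadingCoeff_eq_zero, sub_eq_zero, Nat.cast_inj] at h1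
  tauto

theorem Wr_update_sub_C_mul {R : Type*} [CommRing R] {m : ℕ} (f : Fin m → R[X]) {i j : Fin m}
    (hij : i ≠ j) (c : R) : Wr (Function.update f i (f i - C c * f j)) = Wr f := by
  unfold Wr
  rw [← Matrix.det_updateCol_add_smul_self
    (Matrix.of fun i j : Fin m => derivative^[(i : ℕ)] (f j)) hij (-C c)]
  congr 1
  ext k l : 2
  by_cases hl : l = i
  · subst hl
    simp [iterate_derivative_C_mul, sub_eq_add_neg]
  · simp [hl]

theorem Wr_ne_zero_of_linearIndependent (f : Fin 3 → K[X]) (hf : LinearIndependent K f) :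
    Wr f ≠ 0 := by
  obtain ⟨n, hn⟩ : ∃ n, ∑ i, (f i).natDegree = n := ⟨_, rfl⟩
  induction n using Nat.strong_induction_on generalizing f with
  | _ n ih =>
    have h0 := fun i => hf.ne_zero i
    by_cases hinj : ∀ i j, i ≠ j → (f i).natDegree ≠ (f j).natDegree
    · have := Wr_ne_zero_of_natDegree_ne (h0 0) (h0 1) (h0 2) (hinj 0 1 (by decide))
        (hinj 0 2 (by decide)) (hinj 1 2 (by decide))
      convert this
      ext i : 1
      fin_cases i <;> rfl
    · push Not at hinj
      obtain ⟨i, j, hij, hd⟩ := hinj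
      set c := (f i).leadingCoeff / (f j).leadingCoeff
      have hc : c ≠ 0 := div_ne_zero (leadingCoeff_ne_zero.2 (h0 i)) (leadingCoeff_ne_zero.2 (h0 j))
      rw [← Wr_update_sub_C_mul f hij c]
      have hli : LinearIndependent K (Function.update f i (f i - C c * f j)) :=
        hf.update i _ ⟨1, one_mem _, Finsupp.single i 1 - Finsupp.single j c, by simp [hij], by
          simp [map_sub, smul_eq_C_mul]⟩
      have hlt : (f i - C c * f j).degree < (f i).degree := by
        refine degree_sub_lt_left ?_ (h0 i) ?_
        · rw [degree_C_mul hc, degree_eq_natDegree (h0 i), degree_eq_natDegree (h0 j), hd]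
        · rw [leadingCoeff_mul, leadingCoeff_C,
            div_mul_cancel₀ _ (leadingCoeff_ne_zero.2 (h0 j))]
      have hne : f i - C c * f j ≠ 0 := by simpa using hli.ne_zero i
      refine ih _ ?_ _ hli rfl
      rw [← hn]
      refine Finset.sum_lt_sum (fun k _ => ?_) ⟨i, Finset.mem_univ _, ?_⟩
      · obtain rfl | hk := eq_or_ne k i
        · simpa using (natDegree_lt_natDegree hne hlt).le
        · simp [hk]
      · simpa using natDegree_lt_natDegree hne hlt
end

theorem Wr_sum_C_mul {R : Type*} [CommRing R] {m : ℕ} (f : Fin m → R[X])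
    (B : Matrix (Fin m) (Fin m) R) :
    Wr (fun j => ∑ i, C (B i j) * f i) = C B.det * Wr f := by
  have : (Matrix.of fun k j : Fin m => derivative^[(k : ℕ)] (∑ i, C (B i j) * f i)) =
      (Matrix.of fun k j : Fin m => derivative^[(k : ℕ)] (f j)) * B.map C := by
    ext k j : 1
    simp only [Matrix.of_apply, Matrix.mul_apply, Matrix.map_apply, iterate_derivative_sum,
      iterate_derivative_C_mul]
    exact Finset.sum_congr rfl fun _ _ => mul_comm _ _
  rw [Wr, this, Matrix.det_mul, mul_comm, RingHom.map_det]
  rfl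

theorem linearIndependent_of_Wr_ne_zero {K : Type*} [Field K] {m : ℕ} {f : Fin m → K[X]}
    (hf : Wr f ≠ 0) : LinearIndependent K f := by
  by_contra h
  obtain ⟨g, hg, i, hi⟩ := Fintype.not_linearIndependent_iff.1 h
  refine hf (Matrix.exists_mulVec_eq_zero_iff.1 ⟨fun j => C (g j), fun h0 => hi ?_, ?_⟩)
  · simpa using congrFun h0 i
  · ext k : 1
    have := congrArg (fun p => derivative^[(k : ℕ)] p) hg
    simp only [iterate_derivative_sum, smul_eq_C_mul, iterate_derivative_C_mul,
      iterate_derivative_zero] at this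
    exact (Finset.sum_congr rfl fun _ _ => mul_comm _ _).trans this

/-- `Φ` is, up to a nonzero scalar, the Wronskian of three polynomials of degree at most `5`. -/
def IsWronskian (Φ : ℝ[X]) : Prop :=
  ∃ f : Fin 3 → ℝ[X], (∀ j, f j ∈ degreeLT ℝ 6) ∧ ∃ c : ℝ, c ≠ 0 ∧ Wr f = c • Φ

theorem isWronskian_ofCoeffs_iff {t : Fin 10 → ℝ} :
    IsWronskian (ofCoeffs ℝ 10 t) ↔ ∃ F, ∃ c : ℝ, c ≠ 0 ∧ wronskiCoeff F = c • t := by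
  constructor
  · rintro ⟨f, hf, c, hc, h⟩
    choose F hF using fun j => exists_ofCoeffs_eq (hf j)
    refine ⟨F, c, hc, ofCoeffs_injective ?_⟩
    rw [← Wr_ofCoeffs, map_smul, ← h]
    simp only [hF]
  · rintro ⟨F, c, hc, h⟩
    exact ⟨_, fun j => ofCoeffs_mem_degreeLT (F j), c, hc, by rw [Wr_ofCoeffs, h, map_smul]⟩

theorem continuous_wronskiCoeff : Continuous (wronskiCoeff (R := ℝ)) := by
  refine continuous_pi fun n => ?_
  fin_cases n <;> simp [wronskiCoeff, rowMinor] <;> fun_prop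

theorem wronskiCoeff_ne_zero_of_linearIndependent {F : Fin 3 → Fin 6 → ℝ}
    (hF : LinearIndependent ℝ F) : wronskiCoeff F ≠ 0 := by
  intro h0
  refine Wr_ne_zero_of_linearIndependent _
    (hF.map' (ofCoeffs ℝ 6) (LinearMap.ker_eq_bot.2 ofCoeffs_injective)) ?_
  have := Wr_ofCoeffs F
  rw [h0, map_zero] at this
  exact this

theorem linearIndependent_of_wronskiCoeff_ne_zero {F : Fin 3 → Fin 6 → ℝ}
    (hF : wronskiCoeff F ≠ 0) : LinearIndependent ℝ F := by
  refine LinearIndependent.of_comp (ofCoeffs ℝ 6) (linearIndependent_of_Wr_ne_zero ?_)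
  have := Wr_ofCoeffs F
  rw [Function.comp_def, this]
  exact fun h => hF (ofCoeffs_injective (h.trans (map_zero _).symm))

theorem wronskiCoeff_sum_smul (F : Fin 3 → Fin 6 → ℝ) (B : Matrix (Fin 3) (Fin 3) ℝ) :
    wronskiCoeff (fun j => ∑ i, B i j • F i) = B.det • wronskiCoeff F := by
  apply ofCoeffs_injective
  rw [map_smul, ← Wr_ofCoeffs, ← Wr_ofCoeffs, smul_eq_C_mul, ← Wr_sum_C_mul]
  simp only [map_sum, map_smul, smul_eq_C_mul]

theorem exists_orthonormal_wronskiCoeff_eq {F : Fin 3 → Fin 6 → ℝ} (hF : wronskiCoeff F ≠ 0) :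
    ∃ O : Fin 3 → EuclideanSpace ℝ (Fin 6), Orthonormal ℝ O ∧
      ∃ c : ℝ, c ≠ 0 ∧ wronskiCoeff F = c • wronskiCoeff fun j => (O j).ofLp := by
  set v : Fin 3 → EuclideanSpace ℝ (Fin 6) := fun j => WithLp.toLp 2 (F j) with hv
  have hli : LinearIndependent ℝ v := (linearIndependent_of_wronskiCoeff_ne_zero hF).map'
    (WithLp.linearEquiv 2 ℝ (Fin 6 → ℝ)).symm.toLinearMap (LinearEquiv.ker _)
  set b := (stdOrthonormalBasis ℝ (Submodule.span ℝ (Set.range v))).reindex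
    (finCongr ((finrank_span_eq_card hli).trans (Fintype.card_fin 3)))
  refine ⟨fun j => b j, b.orthonormal.comp_linearIsometry (Submodule.subtypeₗᵢ _), ?_⟩
  have hmem : ∀ j, v j ∈ Submodule.span ℝ (Set.range v) := fun j => Submodule.subset_span ⟨j, rfl⟩
  have key : F = fun j => ∑ i, (Matrix.of fun i j => b.repr ⟨v j,
      hmem j⟩ i) i j • (b i).1.ofLp := by
    ext1 j
    have := congrArg (fun x => (Subtype.val x).ofLp) (b.sum_repr ⟨v j, hmem j⟩)
    simpa [hv] using this.symm
  have h := wronskiCoeff_sum_smul (fun i => (b i).1.ofLp) (Matrix.of fun i j => b.repr ⟨v j,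
      hmem j⟩ i)
  rw [← key] at h
  refine ⟨_, fun h0 => hF ?_, h⟩
  rw [h, h0, zero_smul]

theorem isCompact_setOf_orthonormal {ι E : Type*} [Fintype ι] [NormedAddCommGroup E]
    [InnerProductSpace ℝ E] [FiniteDimensional ℝ E] :
    IsCompact {v : ι → E | Orthonormal ℝ v} := by
  classical
  have : ProperSpace E := FiniteDimensional.proper ℝ E
  refine Metric.isCompact_of_isClosed_isBounded ?_ ?_
  · simp only [orthonormal_iff_ite, Set.ofPred_forall]
    exact isClosed_iInter fun i => isClosed_iInter fun j =>
      isClosed_eq (by fun_prop) continuous_const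
  · refine (Metric.isBounded_closedBall (x := (0 : ι → E)) (r := 1)).subset fun v hv => ?_
    rw [mem_closedBall_zero_iff, pi_norm_le_iff_of_nonneg zero_le_one]
    exact fun i => (hv.1 i).le

open Filter Topology in
/-- The set of Wronskians is closed, since the Grassmannian is compact. -/
theorem IsWronskian.of_frequently {Φ Ψ : ℝ[X]} (h0 : Φ ≠ 0) (hΦ : Φ ∈ degreeLT ℝ 10)
    (hΨ : Ψ ∈ degreeLT ℝ 10) (h : ∃ᶠ ε in 𝓝 (0 : ℝ), IsWronskian (Φ + ε • Ψ)) :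
    IsWronskian Φ := by
  obtain ⟨t, rfl⟩ := exists_ofCoeffs_eq hΦ
  obtain ⟨s, rfl⟩ := exists_ofCoeffs_eq hΨ
  simp only [← map_smul, ← map_add, isWronskian_ofCoeffs_iff] at h ⊢
  have ht : t ≠ 0 := by rintro rfl; simp at h0
  set N : (Fin 10 → ℝ) → Fin 10 → ℝ := fun y => ‖y‖⁻¹ • y with hN
  have hNc : ∀ y ≠ 0, ContinuousAt N y := fun y hy =>
    (continuous_norm.continuousAt.inv₀ (norm_ne_zero_iff.2 hy)).smul continuousAt_id
  set w : (Fin 3 → EuclideanSpace ℝ (Fin 6)) → Fin 10 → ℝ :=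
    fun O => wronskiCoeff fun j => (O j).ofLp with hw
  have hwc : Continuous w := continuous_wronskiCoeff.comp (by fun_prop)
  have hw0 : ∀ O, Orthonormal ℝ O → w O ≠ 0 := fun O hO =>
    wronskiCoeff_ne_zero_of_linearIndependent (hO.linearIndependent.map'
      (WithLp.linearEquiv 2 ℝ (Fin 6 → ℝ)).toLinearMap (LinearEquiv.ker _))
  set U : Set (Fin 10 → ℝ) := (fun O => N (w O)) '' {O | Orthonormal ℝ O} with hU
  have hUc : IsClosed (U ∪ -U) := by
    have : IsCompact U := isCompact_setOf_orthonormal.image_of_continuousOn fun O hO =>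
      ((hNc _ (hw0 O hO)).comp hwc.continuousAt).continuousWithinAt
    exact this.isClosed.union this.neg.isClosed
  have hlim : Tendsto (fun ε : ℝ => t + ε • s) (𝓝 0) (𝓝 t) := by
    have : Continuous fun ε : ℝ => t + ε • s := by fun_prop
    simpa using this.tendsto 0
  have hmem : N t ∈ U ∪ -U := by
    refine hUc.mem_of_frequently_of_tendsto ?_ ((hNc t ht).tendsto.comp hlim)
    refine (h.and_eventually (hlim.eventually_ne ht)).mono ?_
    rintro ε ⟨⟨F, c, hc, hF⟩, hne⟩
    obtain ⟨O, hO, d, hd, hFO⟩ :=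
      exists_orthonormal_wronskiCoeff_eq (F := F) (by rw [hF]; exact smul_ne_zero hc hne)
    have hts : t + ε • s = (c⁻¹ * d) • w O := by
      rw [hw, mul_smul, ← hFO, hF, inv_smul_smul₀ hc]
    have hcd : c⁻¹ * d ≠ 0 := mul_ne_zero (inv_ne_zero hc) hd
    have hNs : N (t + ε • s) = (|c⁻¹ * d|⁻¹ * (c⁻¹ * d)) • N (w O) := by
      simp only [hN, hts, norm_smul, Real.norm_eq_abs, smul_smul, mul_inv]
      congr 1
      ring
    simp only [Function.comp]
    rcases hcd.lt_or_gt with hlt | hgt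
    · right
      rw [hNs, abs_of_neg hlt, inv_neg, neg_mul, inv_mul_cancel₀ hcd, neg_one_smul]
      simpa using ⟨O, hO, rfl⟩
    · left
      rw [hNs, abs_of_pos hgt, inv_mul_cancel₀ hcd, one_smul]
      exact ⟨O, hO, rfl⟩
  have ht' : ‖t‖ ≠ 0 := norm_ne_zero_iff.2 ht
  rcases hmem with ⟨O, hO, h1⟩ | ⟨O, hO, h1⟩
  · have hn : ‖w O‖ ≠ 0 := norm_ne_zero_iff.2 (hw0 O hO)
    refine ⟨fun j => (O j).ofLp, ‖w O‖ * ‖t‖⁻¹, mul_ne_zero hn (inv_ne_zero ht'), ?_⟩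
    rw [mul_smul]
    change w O = ‖w O‖ • N t
    rw [← h1]
    exact (smul_inv_smul₀ hn _).symm
  · have hn : ‖w O‖ ≠ 0 := norm_ne_zero_iff.2 (hw0 O hO)
    refine ⟨fun j => (O j).ofLp, -‖w O‖ * ‖t‖⁻¹,
      mul_ne_zero (neg_ne_zero.2 hn) (inv_ne_zero ht'), ?_⟩
    rw [mul_smul]
    change w O = -‖w O‖ • N t
    rw [neg_smul, ← smul_neg, ← h1]
    exact (smul_inv_smul₀ hn _).symm

theorem IsWronskian.smul {Φ : ℝ[X]} (h : IsWronskian Φ) {a : ℝ} (ha : a ≠ 0) :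
    IsWronskian (a • Φ) := by
  obtain ⟨f, hf, c, hc, h⟩ := h
  exact ⟨f, hf, c * a⁻¹, mul_ne_zero hc (inv_ne_zero ha), by
    rw [h, smul_smul, inv_mul_cancel_right₀ ha]⟩

theorem Wr_taylor {R : Type*} [CommRing R] {m : ℕ} (f : Fin m → R[X]) (r : R) :
    Wr (fun j => taylor r (f j)) = taylor r (Wr f) := by
  have h : ∀ p : R[X], derivative (taylor r p) = taylor r (derivative p) := fun p => by
    simp [taylor_apply, derivative_comp]
  change _ = (taylorAlgHom r : R[X] →+* R[X]) _
  rw [Wr, Wr, RingHom.map_det]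
  congr 1
  ext i j : 1
  exact (Function.Semiconj.iterate_right (f := taylor r) (ga := derivative) (gb := derivative)
    (fun p => (h p).symm) i (f j)).symm

theorem IsWronskian.taylor {Φ : ℝ[X]} (h : IsWronskian Φ) (r : ℝ) :
    IsWronskian (taylor r Φ) := by
  obtain ⟨f, hf, c, hc, h⟩ := h
  refine ⟨fun j => Polynomial.taylor r (f j), fun j => ?_, c, hc, by rw [Wr_taylor, h, map_smul]⟩
  have := hf j
  rwa [mem_degreeLT, degree_taylor, ← mem_degreeLT]

theorem IsWronskian.of_taylor {Φ : ℝ[X]} {r : ℝ} (h : IsWronskian (Polynomial.taylor r Φ)) :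
    IsWronskian Φ := by
  simpa [taylor_taylor] using h.taylor (-r)

theorem IsWronskian.of_comp_rev {t : Fin 10 → ℝ} (h : IsWronskian (ofCoeffs ℝ 10 (t ∘ Fin.rev))) :
    IsWronskian (ofCoeffs ℝ 10 t) := by
  rw [isWronskian_ofCoeffs_iff] at h ⊢
  obtain ⟨F, c, hc, h⟩ := h
  refine ⟨_, -c, neg_ne_zero.2 hc, (wronskiCoeff_comp_rev F).trans ?_⟩
  rw [h]
  ext n
  simp

open Filter Topology in
theorem frequently_eval_ne_zero {P : ℝ[X]} (hP : P ≠ 0) (x : ℝ) :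
    ∃ᶠ y in 𝓝 x, P.eval y ≠ 0 := by
  intro h
  simp only [ne_eq, not_not] at h
  exact hP (eq_zero_of_infinite_isRoot P (infinite_of_mem_nhds x h))

theorem mem_degreeLT_ten_of_natDegree_le {Φ : ℝ[X]} (h : Φ.natDegree ≤ 9) :
    Φ ∈ degreeLT ℝ 10 := by
  rw [mem_degreeLT]
  exact (natDegree_le_iff_degree_le.1 h).trans_lt (by norm_num)

open Filter Topology in
theorem isWronskian_ofCoeffs_of_monic {t : Fin 10 → ℝ} (h7 : t 7 = 0) (h8 : t 8 = 1)
    (h9 : t 9 = 0) : IsWronskian (ofCoeffs ℝ 10 t) := by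
  have hX : ofCoeffs ℝ 10 (Pi.single 1 1) = X := by
    rw [ofCoeffs_apply]
    simp [Fin.sum_univ_succ, Pi.single_apply, monomial_one_one_eq_X]
  refine IsWronskian.of_frequently (Ψ := ofCoeffs ℝ 10 (Pi.single 1 1)) ?_
    (ofCoeffs_mem_degreeLT _) (ofCoeffs_mem_degreeLT _) ?_
  · refine fun h0 => one_ne_zero (α := ℝ) ?_
    rw [← h8, ← coeff_ofCoeffs t 8, h0, coeff_zero]
  obtain ⟨p₂, h6⟩ : ∃ p, t 6 = 40 / 3 * p := ⟨3 / 40 * t 6, by ring⟩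
  obtain ⟨p₃, h5⟩ : ∃ p, t 5 = -48 * p := ⟨-t 5 / 48, by ring⟩
  obtain ⟨p₄, h4⟩ : ∃ p, t 4 = 240 * p := ⟨t 4 / 240, by ring⟩
  obtain ⟨p₅, h3⟩ : ∃ p, t 3 = 320 * p := ⟨t 3 / 320, by ring⟩
  obtain ⟨p₆, h2⟩ : ∃ p, t 2 = -960 * p := ⟨-t 2 / 960, by ring⟩
  obtain ⟨p₈, h0⟩ : ∃ p, t 0 = 960 * p := ⟨t 0 / 960, by ring⟩
  set y₀ := -(p₂ ^ 2 * p₃) - t 1 / 960 with hy₀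
  have hlim : Tendsto (fun y => 960 * (y₀ - y)) (𝓝 y₀) (𝓝 0) := by
    have : Continuous fun y => 960 * (y₀ - y) := by fun_prop
    simpa using this.tendsto y₀
  refine hlim.frequently ((frequently_eval_ne_zero (P := Cubic.toPoly
    ⟨1, -(p₃ * (-3 * p₂ ^ 2 + 6 * p₄)), p₃ ^ 2 * (-9 * (p₂ * p₃ ^ 2 - (2 / 3) * p₂ * p₆ +
      (4 / 3) * p₂ ^ 2 * p₄ - p₂ ^ 4 / 3 - p₃ * p₅ - p₄ ^ 2 - p₈)),
      p₃ ^ 3 * (3 * (-p₂ * p₄ + p₂ ^ 3 / 3 + p₆)) ^ 2⟩)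
    (Cubic.ne_zero_of_a_ne_zero one_ne_zero) y₀).mono fun y hy => ?_)
  rw [← map_smul, ← map_add, isWronskian_ofCoeffs_iff]
  obtain ⟨F, hF⟩ := exists_wronskiCoeff_eq_of_ne_zero p₂ p₃ p₄ p₅ p₆ (-(p₂ ^ 2 * p₃) - y) p₈ (by
    convert hy using 1
    simp only [Cubic.toPoly, eval_add, eval_mul, eval_C, eval_pow, eval_X]
    ring)
  refine ⟨F, 1 / 960, by norm_num, hF.trans ?_⟩
  congr 1
  ext n
  fin_cases n <;> simp [h0, h2, h3, h4, h5, h6, h7, h8, h9, hy₀]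
  ring

theorem isWronskian_of_natDegree_eq_eight {Φ : ℝ[X]} (h : Φ.natDegree = 8) : IsWronskian Φ := by
  have h8 : Φ.coeff 8 ≠ 0 := by
    rw [← h]
    exact leadingCoeff_ne_zero.2 (ne_zero_of_natDegree_gt (n := 7) (by omega))
  set r := -Φ.coeff 7 / (8 * Φ.coeff 8) with hr
  suffices hs : IsWronskian ((Φ.coeff 8)⁻¹ • taylor r Φ) by
    refine IsWronskian.of_taylor (r := r) ?_
    simpa [smul_smul, h8] using hs.smul h8
  have h7 : (taylor r Φ).coeff 7 = 0 := by
    have hd : (hasseDeriv 7 Φ).natDegree ≤ 1 := (natDegree_hasseDeriv_le _ _).trans (by omega)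
    rw [taylor_coeff, eq_X_add_C_of_natDegree_le_one hd, hasseDeriv_coeff, hasseDeriv_coeff]
    norm_num [hr]
    field_simp
    ring
  obtain ⟨t, ht⟩ := exists_ofCoeffs_eq (p := (Φ.coeff 8)⁻¹ • taylor r Φ)
    (mem_degreeLT_ten_of_natDegree_le ((natDegree_smul_le _ _).trans (by
      rw [natDegree_taylor]; omega)))
  have hcoeff : ∀ n : Fin 10, t n = (Φ.coeff 8)⁻¹ * (taylor r Φ).coeff n := fun n => by
    rw [← coeff_ofCoeffs t n, ht, coeff_smul, smul_eq_mul]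
  rw [← ht]
  refine isWronskian_ofCoeffs_of_monic ?_ ?_ ?_
  · exact (hcoeff 7).trans (mul_eq_zero_of_right _ h7)
  · rw [hcoeff, show ((8 : Fin 10) : ℕ) = Φ.natDegree by rw [h]; rfl, coeff_taylor_natDegree,
      leadingCoeff, h, inv_mul_cancel₀ h8]
  · refine (hcoeff 9).trans (mul_eq_zero_of_right _ (coeff_eq_zero_of_natDegree_lt ?_))
    rw [natDegree_taylor, h]
    decide

open Filter Topology in
theorem IsWronskian.of_forall_natDegree_eq {n : ℕ} (hn : n ≤ 9)
    (H : ∀ Φ : ℝ[X], Φ.natDegree = n → IsWronskian Φ) {Φ : ℝ[X]} (h0 : Φ ≠ 0)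
    (h : Φ.natDegree ≤ n) : IsWronskian Φ := by
  refine IsWronskian.of_frequently (Ψ := X ^ n) h0 (mem_degreeLT_ten_of_natDegree_le (h.trans hn))
    (mem_degreeLT_ten_of_natDegree_le (by simpa using hn)) ?_
  refine (frequently_eval_ne_zero (X_add_C_ne_zero (Φ.coeff n)) 0).mono fun ε hε => H _ ?_
  refine natDegree_eq_of_le_of_coeff_ne_zero (natDegree_add_le_of_degree_le h
    ((natDegree_smul_le _ _).trans (by simp))) ?_
  simpa [add_comm] using hε

theorem isWronskian_of_natDegree_eq_nine {Φ : ℝ[X]} (h : Φ.natDegree = 9) : IsWronskian Φ := by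
  obtain ⟨r, hr⟩ := exists_isRoot_of_odd_natDegree_real (p := Φ) (by rw [h]; decide)
  apply IsWronskian.of_taylor (r := r)
  have h0 : taylor r Φ ≠ 0 := ne_zero_of_natDegree_gt (n := 0) (by rw [natDegree_taylor]; omega)
  obtain ⟨t, ht⟩ := exists_ofCoeffs_eq (p := taylor r Φ)
    (mem_degreeLT_ten_of_natDegree_le (by rw [natDegree_taylor]; omega))
  have ht0 : t 0 = 0 := by
    rw [← coeff_ofCoeffs t 0, ht]
    simpa using hr
  rw [← ht] at h0 ⊢
  refine IsWronskian.of_comp_rev (IsWronskian.of_forall_natDegree_eq (n := 8) (by norm_num)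
    (fun _ => isWronskian_of_natDegree_eq_eight) (fun h1 => h0 ?_) ?_)
  · rw [← map_zero (ofCoeffs ℝ 10), ofCoeffs_injective.eq_iff] at h1 ⊢
    ext n
    simpa using congrFun h1 n.rev
  · rw [natDegree_le_iff_coeff_eq_zero]
    intro n hn
    obtain rfl | hn' := (show 9 ≤ n from hn).eq_or_lt
    · rw [show 9 = ((9 : Fin 10) : ℕ) from rfl, coeff_ofCoeffs]
      exact ht0
    · exact coeff_eq_zero_of_degree_lt ((mem_degreeLT.1 (ofCoeffs_mem_degreeLT _)).trans_le
        (by exact_mod_cast hn'))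

/-- **Theorem.**  Every nonzero real polynomial `Φ` of degree at most `9` is, up to a nonzero
real scalar, the Wronskian of a basis of some 3-dimensional real subspace of the space of real
polynomials of degree at most `5`. -/
theorem real_wronski_surjective_deg9 (Φ : ℝ[X]) (hΦ : Φ ≠ 0) (hdeg : Φ.natDegree ≤ 9) :
    ∃ H : Submodule ℝ ℝ[X], H ≤ degreeLT ℝ 6 ∧ Module.finrank ℝ H = 3 ∧
      ∃ f : Fin 3 → ℝ[X], LinearIndependent ℝ f ∧ Submodule.span ℝ (Set.range f) = H ∧
        ∃ c : ℝ, c ≠ 0 ∧ Wr f = c • Φ := by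
  obtain ⟨f, hf, c, hc, h⟩ := IsWronskian.of_forall_natDegree_eq le_rfl
    (fun _ => isWronskian_of_natDegree_eq_nine) hΦ hdeg
  have hli : LinearIndependent ℝ f :=
    linearIndependent_of_Wr_ne_zero (by rw [h]; exact smul_ne_zero hc hΦ)
  refine ⟨Submodule.span ℝ (Set.range f), ?_, ?_, f, hli, rfl, c, hc, h⟩
  · rw [Submodule.span_le]
    rintro _ ⟨j, rfl⟩
    exact hf j
  · rw [finrank_span_eq_card hli, Fintype.card_fin]
end

section
/- Let m ≥ 1 and let B = B_{2m−1} be the canonical symplectic form on complex polynomials of degree at most 2m−1. Let H be an m-dimensional ℂ-linear subspace of the space of complex polynomials of degree at most 2m−1, and let H^∠ = {v : deg v ≤ 2m−1 and B(u,v) = 0 for all u ∈ H} be its symplectic orthogonal (which is also m-dimensional). Then for every basis f₁,…,f_m of H and every basis g₁,…,g_m of H^∠, there exists a nonzero c ∈ ℂ with Wr(g₁,…,g_m) = c·Wr(f₁,…,f_m). In other words, the Wronski map commutes with the Lagrangian involution H ↦ H^∠. -/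
open Polynomial

/-- The canonical bilinear form `B_r` on polynomials of degree at most `r`:
`B_r(u,v) = Σ_{i=0}^{r} (−1)^i · i! · (r−i)! · u_i · v_{r−i}`. -/
noncomputable def Bform (K : Type*) [Field K] (r : ℕ) (u v : K[X]) : K :=
  ∑ i ∈ Finset.range (r + 1),
    (-1 : K) ^ i * (Nat.factorial i : K) * (Nat.factorial (r - i) : K) *
      u.coeff i * v.coeff (r - i)

section

variable {K : Type*} [Field K]

theorem Bform_add_left (r : ℕ) (u u' v : K[X]) :
    Bform K r (u + u') v = Bform K r u v + Bform K r u' v := by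
  simp only [Bform, coeff_add, ← Finset.sum_add_distrib]
  exact Finset.sum_congr rfl fun _ _ => by ring

theorem Bform_smul_left (r : ℕ) (c : K) (u v : K[X]) :
    Bform K r (c • u) v = c • Bform K r u v := by
  simp only [Bform, coeff_smul, smul_eq_mul, Finset.mul_sum]
  exact Finset.sum_congr rfl fun _ _ => by ring

theorem Bform_add_right (r : ℕ) (u v v' : K[X]) :
    Bform K r u (v + v') = Bform K r u v + Bform K r u v' := by
  simp only [Bform, coeff_add, ← Finset.sum_add_distrib]
  exact Finset.sum_congr rfl fun _ _ => by ring

theorem Bform_smul_right (r : ℕ) (c : K) (u v : K[X]) :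
    Bform K r u (c • v) = c • Bform K r u v := by
  simp only [Bform, coeff_smul, smul_eq_mul, Finset.mul_sum]
  exact Finset.sum_congr rfl fun _ _ => by ring

/-- The canonical form `Bform` as a bilinear map. -/
noncomputable def bformBilin (K : Type*) [Field K] (r : ℕ) : K[X] →ₗ[K] K[X] →ₗ[K] K :=
  LinearMap.mk₂ K (Bform K r) (Bform_add_left r) (Bform_smul_left r) (Bform_add_right r)
    (Bform_smul_right r)

@[simp]
theorem bformBilin_apply (r : ℕ) (u v : K[X]) : bformBilin K r u v = Bform K r u v := rfl

theorem iterate_derivative_eq_zero_of_mem_degreeLT {n : ℕ} {u : K[X]} (hu : u ∈ degreeLT K n) :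
    derivative^[n] u = 0 := by
  by_cases h : u = 0
  · simp [h]
  · exact iterate_derivative_eq_zero ((natDegree_lt_iff_degree_lt h).2 (mem_degreeLT.1 hu))

theorem exists_complementary_family {m : ℕ} {f : Fin m → K[X]} (hli : LinearIndependent K f)
    (hf : ∀ k, f k ∈ degreeLT K (2 * m)) :
    ∃ f' : Fin m → K[X], LinearIndependent K (Sum.elim f f') ∧
      Submodule.span K (Set.range (Sum.elim f f')) = degreeLT K (2 * m) := by
  let F : Fin m → degreeLT K (2 * m) := fun k => ⟨f k, hf k⟩
  have hF : LinearIndependent K F := LinearIndependent.of_comp (degreeLT K (2 * m)).subtype hli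
  let e := degreeLTEquiv K (2 * m)
  have : Module.Finite K (degreeLT K (2 * m)) := Module.Finite.equiv e.symm
  let b := Module.Basis.sumExtend hF
  have : Finite (Fin m ⊕ Module.Basis.sumExtendIndex hF) := Module.Finite.finite_basis b
  have : Finite (Module.Basis.sumExtendIndex hF) := Finite.sum_right (Fin m)
  have hcard : Nat.card (Module.Basis.sumExtendIndex hF) = m := by
    have h1 := Module.finrank_eq_nat_card_basis b
    rw [Nat.card_sum, e.finrank_eq, Module.finrank_fin_fun, Nat.card_fin] at h1
    omega
  let b' := b.reindex (Equiv.sumCongr (Equiv.refl _) (Finite.equivFinOfCardEq hcard))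
  have hb' : Sum.elim f (fun k => (b' (Sum.inr k) : K[X])) =
      (degreeLT K (2 * m)).subtype ∘ b' := by
    funext k
    rcases k with k | k
    · simp [b', b, Module.Basis.sumExtend]
      rfl
    · rfl
  refine ⟨fun k => b' (Sum.inr k), ?_, ?_⟩
  · rw [hb']
    exact b'.linearIndependent.map' _ (Submodule.ker_subtype _)
  · rw [hb', Set.range_comp, ← Submodule.map_span, b'.span_eq, Submodule.map_top,
      Submodule.range_subtype]

theorem det_Bform_ne_zero {ι : Type*} [Fintype ι] [DecidableEq ι] {r : ℕ} {h g : ι → K[X]}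
    (hg : LinearIndependent K g)
    (hnondeg : ∀ v ∈ Submodule.span K (Set.range g), (∀ k, Bform K r (h k) v = 0) → v = 0) :
    (Matrix.of fun k l => Bform K r (h k) (g l)).det ≠ 0 := by
  rw [Ne, ← Matrix.exists_mulVec_eq_zero_iff]
  rintro ⟨c, hc, hmul⟩
  refine hc (funext (Fintype.linearIndependent_iff.1 hg c (hnondeg _ ?_ fun k => ?_)))
  · exact Submodule.sum_mem _ fun l _ =>
      Submodule.smul_mem _ _ (Submodule.subset_span ⟨l, rfl⟩)
  · rw [← bformBilin_apply, map_sum]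
    refine (Finset.sum_congr rfl fun l _ => ?_).trans (congrFun hmul k)
    simp [mul_comm]

/-- The jets of order `2m - 1` of the polynomials `h k`, with the derivatives of order at least `m`
listed in decreasing order. -/
noncomputable def jetMatrix {ι : Type*} (m : ℕ) (h : ι → K[X]) :
    Matrix ι (Fin m ⊕ Fin m) K[X] :=
  Matrix.of fun k => Sum.elim (fun i => derivative^[(i : ℕ)] (h k))
    fun i => derivative^[2 * m - 1 - i] (h k)

/-- The high order part of the jets of the polynomials `h k`, with the signs of the canonical
form. -/
noncomputable def highJetMatrix {ι : Type*} (m : ℕ) (h : ι → K[X]) : Matrix (Fin m) ι K[X] :=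
  Matrix.of fun i k => (-1) ^ (i : ℕ) * derivative^[2 * m - 1 - i] (h k)

/-- The low order part of the jets of the polynomials `h k`, with the signs of the canonical
form. -/
noncomputable def lowJetMatrix {ι : Type*} (m : ℕ) (h : ι → K[X]) : Matrix (Fin m) ι K[X] :=
  Matrix.of fun i k => (-1) ^ (2 * m - 1 - i) * derivative^[(i : ℕ)] (h k)

theorem det_lowJetMatrix {m : ℕ} (g : Fin m → K[X]) :
    (lowJetMatrix m g).det = (∏ i : Fin m, (-1) ^ (2 * m - 1 - (i : ℕ))) * Wr g :=
  Matrix.det_mul_column (fun i : Fin m => (-1) ^ (2 * m - 1 - (i : ℕ))) _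

variable [CharZero K]

/-- The canonical form is nondegenerate on polynomials of degree at most `r`. -/
theorem eq_zero_of_Bform_eq_zero {r : ℕ} {v : K[X]} (hv : v ∈ degreeLT K (r + 1))
    (h : ∀ u ∈ degreeLT K (r + 1), Bform K r u v = 0) : v = 0 := by
  ext k
  rcases lt_or_ge k (r + 1) with hk | hk
  · have hX : (X ^ (r - k) : K[X]) ∈ degreeLT K (r + 1) := by
      rw [mem_degreeLT, degree_X_pow]
      exact_mod_cast (by omega : r - k < r + 1)
    have hB := h _ hX
    rw [Bform, Finset.sum_eq_single (r - k)] at hB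
    · simpa [Nat.factorial_ne_zero, Nat.sub_sub_self (Nat.lt_succ_iff.1 hk)] using hB
    · intro i _ hi
      simp [coeff_X_pow, hi]
    · intro hi
      exact absurd (Finset.mem_range.2 (by omega)) hi
  · exact coeff_eq_zero_of_degree_lt
      ((mem_degreeLT.1 hv).trans_le (by exact_mod_cast hk))

/-- The canonical form is translation invariant: it is computed by the Taylor coefficients of the
two polynomials at any point. -/
theorem sum_iterate_derivative_eq_C_Bform {r : ℕ} {u v : K[X]} (hu : u ∈ degreeLT K (r + 1))
    (hv : v ∈ degreeLT K (r + 1)) :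
    ∑ i ∈ Finset.range (r + 1), (-1) ^ i * derivative^[i] u * derivative^[r - i] v =
      C (Bform K r u v) := by
  have hder : derivative (∑ i ∈ Finset.range (r + 1),
      (-1) ^ i * derivative^[i] u * derivative^[r - i] v) = 0 := by
    have hterm : ∀ i ∈ Finset.range (r + 1),
        derivative ((-1) ^ i * derivative^[i] u * derivative^[r - i] v) =
          (-1) ^ i * derivative^[i] u * derivative^[r + 1 - i] v -
            (-1) ^ (i + 1) * derivative^[i + 1] u * derivative^[r + 1 - (i + 1)] v := by
      intro i hi
      have hsub : r + 1 - i = r - i + 1 := by have := Finset.mem_range.1 hi; omega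
      have hsign : derivative ((-1 : K[X]) ^ i) = 0 := by simp
      rw [hsub, Nat.add_sub_add_right, Function.iterate_succ_apply', Function.iterate_succ_apply',
        derivative_mul, derivative_mul, hsign]
      ring
    rw [derivative_sum, Finset.sum_congr rfl hterm,
      Finset.sum_range_sub' fun i => (-1) ^ i * derivative^[i] u * derivative^[r + 1 - i] v]
    simp [iterate_derivative_eq_zero_of_mem_degreeLT hv,
      iterate_derivative_eq_zero_of_mem_degreeLT hu, -Function.iterate_succ]
  rw [eq_C_of_natDegree_eq_zero (derivative_eq_zero.1 hder)]
  congr 1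
  rw [finsetSum_coeff, Bform]
  refine Finset.sum_congr rfl fun i _ => ?_
  rw [mul_coeff_zero, mul_coeff_zero, coeff_iterate_derivative, coeff_iterate_derivative]
  simp [coeff_zero_eq_eval_zero, Nat.descFactorial_self]
  ring

theorem jetMatrix_mul_fromRows {ι κ : Type*} {m : ℕ} (hm : 1 ≤ m) {h : ι → K[X]} {g : κ → K[X]}
    (hh : ∀ k, h k ∈ degreeLT K (2 * m)) (hg : ∀ k, g k ∈ degreeLT K (2 * m)) :
    jetMatrix m h * Matrix.fromRows (highJetMatrix m g) (lowJetMatrix m g) =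
      (Matrix.of fun k l => Bform K (2 * m - 1) (h k) (g l)).map C := by
  have hr : 2 * m - 1 + 1 = 2 * m := by omega
  refine Matrix.ext fun k l => ?_
  rw [Matrix.map_apply, Matrix.of_apply,
    ← sum_iterate_derivative_eq_C_Bform (by rw [hr]; exact hh k) (by rw [hr]; exact hg l), hr,
    two_mul m, Finset.sum_range_add,
    ← Finset.sum_range_reflect (fun i => (-1) ^ (m + i) * derivative^[m + i] (h k) * _) m,
    Finset.sum_range, Finset.sum_range, Matrix.mul_apply, Fintype.sum_sum_type]
  congr 1
  · refine Finset.sum_congr rfl fun i _ => ?_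
    simp [jetMatrix, highJetMatrix, two_mul]
    ring
  · refine Finset.sum_congr rfl fun i _ => ?_
    have h1 : m + (m - 1 - (i : ℕ)) = m + m - 1 - i := by omega
    have h2 : m + m - 1 - (m + m - 1 - (i : ℕ)) = i := by omega
    simp only [jetMatrix, lowJetMatrix, two_mul, h1, h2, Matrix.of_apply, Sum.elim_inr,
      Matrix.fromRows_apply_inr]
    ring

theorem det_jetMatrix_mul_det_lowJetMatrix {m : ℕ} (hm : 1 ≤ m) {f f' g : Fin m → K[X]}
    (hf : ∀ k, f k ∈ degreeLT K (2 * m)) (hf' : ∀ k, f' k ∈ degreeLT K (2 * m))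
    (hg : ∀ k, g k ∈ degreeLT K (2 * m)) (hfg : ∀ k l, Bform K (2 * m - 1) (f k) (g l) = 0) :
    (jetMatrix m (Sum.elim f f')).det * (lowJetMatrix m g).det =
      Wr f * C (Matrix.of fun k l => Bform K (2 * m - 1) (f' k) (g l)).det := by
  have hmul := jetMatrix_mul_fromRows hm (h := Sum.elim f f') (by rintro (k | k) <;> simp [hf, hf'])
    hg
  have key : jetMatrix m (Sum.elim f f') *
      Matrix.fromBlocks 1 (highJetMatrix m g) 0 (lowJetMatrix m g) =
      Matrix.fromBlocks (Matrix.of fun i j : Fin m => derivative^[(i : ℕ)] (f j)).transpose 0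
        (Matrix.of fun i j : Fin m => derivative^[(i : ℕ)] (f' j)).transpose
        ((Matrix.of fun k l => Bform K (2 * m - 1) (f' k) (g l)).map C) := by
    refine Matrix.ext fun k l => ?_
    rcases l with l | l
    · rcases k with k | k <;>
        simp [Matrix.mul_apply, Fintype.sum_sum_type, Matrix.one_apply, jetMatrix]
    · have := congrFun (congrFun hmul k) l
      rw [Matrix.mul_apply, Fintype.sum_sum_type] at this ⊢
      rcases k with k | k <;> simpa [hfg] using this
  have hdet := congrArg Matrix.det key
  rwa [Matrix.det_mul, Matrix.det_fromBlocks_zero₂₁, Matrix.det_one, one_mul,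
    Matrix.det_fromBlocks_zero₁₂, Matrix.det_transpose, ← RingHom.mapMatrix_apply,
    ← RingHom.map_det] at hdet

theorem isUnit_det_jetMatrix {m : ℕ} (hm : 1 ≤ m) {h : Fin m ⊕ Fin m → K[X]}
    (hli : LinearIndependent K h)
    (hspan : Submodule.span K (Set.range h) = degreeLT K (2 * m))
    (hnondeg : ∀ v ∈ degreeLT K (2 * m), (∀ k, Bform K (2 * m - 1) (h k) v = 0) → v = 0) :
    IsUnit (jetMatrix m h).det := by
  have hh : ∀ k, h k ∈ degreeLT K (2 * m) := fun k => hspan ▸ Submodule.subset_span ⟨k, rfl⟩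
  have hdet := congrArg Matrix.det (jetMatrix_mul_fromRows hm hh hh)
  rw [Matrix.det_mul, ← RingHom.mapMatrix_apply, ← RingHom.map_det] at hdet
  refine isUnit_of_mul_isUnit_left (hdet ▸ isUnit_C.2 (isUnit_iff_ne_zero.2 ?_))
  exact det_Bform_ne_zero hli (hspan ▸ hnondeg)

end

/-- **Lemma (the Wronski map commutes with the Lagrangian involution).**  Let `H` be an
`m`-dimensional subspace of the complex polynomials of degree at most `2m−1`, and let `H^∠`
be its orthogonal complement for the canonical symplectic form `B_{2m−1}`.  Then the Wronskian
of any basis of `H^∠` is a nonzero scalar multiple of the Wronskian of any basis of `H`. -/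
theorem wronski_commutes_with_lagrangian_involution (m : ℕ) (hm : 1 ≤ m)
    (H : Submodule ℂ ℂ[X]) (hH : H ≤ degreeLT ℂ (2 * m)) (hrank : Module.finrank ℂ H = m)
    (f g : Fin m → ℂ[X])
    (hf : LinearIndependent ℂ f) (hfspan : Submodule.span ℂ (Set.range f) = H)
    (hg : LinearIndependent ℂ g)
    (hgspan : (Submodule.span ℂ (Set.range g) : Set ℂ[X]) =
      {v : ℂ[X] | v ∈ degreeLT ℂ (2 * m) ∧ ∀ u ∈ H, Bform ℂ (2 * m - 1) u v = 0}) :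
    ∃ c : ℂ, c ≠ 0 ∧ Wr g = c • Wr f := by
  have hr : 2 * m - 1 + 1 = 2 * m := by omega
  have hfH : ∀ k, f k ∈ H := fun k => hfspan ▸ Submodule.subset_span ⟨k, rfl⟩
  have hfm : ∀ k, f k ∈ degreeLT ℂ (2 * m) := fun k => hH (hfH k)
  have hgs : ∀ v ∈ Submodule.span ℂ (Set.range g),
      v ∈ degreeLT ℂ (2 * m) ∧ ∀ u ∈ H, Bform ℂ (2 * m - 1) u v = 0 := fun v hv =>
    hgspan.subset hv
  have hgo : ∀ k, g k ∈ degreeLT ℂ (2 * m) ∧ ∀ u ∈ H, Bform ℂ (2 * m - 1) u (g k) = 0 :=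
    fun k => hgs _ (Submodule.subset_span ⟨k, rfl⟩)
  obtain ⟨f', hli, hspan⟩ := exists_complementary_family hf hfm
  have hf'm : ∀ k, f' k ∈ degreeLT ℂ (2 * m) := fun k =>
    hspan ▸ Submodule.subset_span ⟨Sum.inr k, rfl⟩
  have hnondeg : ∀ v ∈ degreeLT ℂ (2 * m),
      (∀ k, Bform ℂ (2 * m - 1) (Sum.elim f f' k) v = 0) → v = 0 := by
    intro v hv hk
    refine eq_zero_of_Bform_eq_zero (r := 2 * m - 1) (by rwa [hr]) fun u hu => ?_
    rw [hr, ← hspan] at hu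
    have hle : Submodule.span ℂ (Set.range (Sum.elim f f')) ≤
        LinearMap.ker ((bformBilin ℂ (2 * m - 1)).flip v) := by
      rw [Submodule.span_le]
      rintro _ ⟨k, rfl⟩
      exact hk k
    exact hle hu
  have hN : (Matrix.of fun k l => Bform ℂ (2 * m - 1) (f' k) (g l)).det ≠ 0 := by
    refine det_Bform_ne_zero hg fun v hv hk => hnondeg v (hgs v hv).1 ?_
    rintro (k | k)
    · exact (hgs v hv).2 _ (hfH k)
    · exact hk k
  obtain ⟨a, ha, haA⟩ := isUnit_iff.1 (isUnit_det_jetMatrix hm hli hspan hnondeg)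
  have key := det_jetMatrix_mul_det_lowJetMatrix hm hfm hf'm (fun k => (hgo k).1)
    fun k l => (hgo l).2 _ (hfH k)
  set N := (Matrix.of fun k l => Bform ℂ (2 * m - 1) (f' k) (g l)).det
  have hs : (∏ i : Fin m, (-1) ^ (2 * m - 1 - (i : ℕ)) : ℂ[X]) =
      C (∏ i : Fin m, (-1) ^ (2 * m - 1 - (i : ℕ))) := by
    simp [map_prod]
  have hs0 : (∏ i : Fin m, (-1) ^ (2 * m - 1 - (i : ℕ)) : ℂ) ≠ 0 :=
    Finset.prod_ne_zero_iff.2 fun i _ => pow_ne_zero _ (by norm_num)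
  rw [← haA, det_lowJetMatrix, hs] at key
  set s : ℂ := ∏ i : Fin m, (-1) ^ (2 * m - 1 - (i : ℕ))
  have has : a * s ≠ 0 := mul_ne_zero ha.ne_zero hs0
  refine ⟨(a * s)⁻¹ * N, mul_ne_zero (inv_ne_zero has) hN, ?_⟩
  rw [mul_smul, eq_inv_smul_iff₀ has, smul_eq_C_mul, smul_eq_C_mul, C_mul, mul_assoc, key, mul_comm]
end
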